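/- arXiv:1310.0416 — 4 statements merged into one kernel-verified Lean document; each statement's English description precedes it below -/
import Mathlib

section
/- For every positive integer n and every positive integer k, the matrix ring Mₙ(ℤ/2ᵏℤ) is nil-clean. -/
/-- An element of a ring is nil-clean if it is the sum of an idempotent and a nilpotent. -/
def IsNilCleanRing (R : Type*) [Ring R] : Prop :=
  ∀ a : R, ∃ e n : R, IsIdempotentElem e ∧ IsNilpotent n ∧ a = e + n

theorem nc_span_top {V : Type*} [AddCommGroup V] [Module (ZMod 2) V] (b : ℕ → V) (s : ℕ) :
    ∀ x ∈ Submodule.span (ZMod 2) (b '' Set.Iio s),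
      x = 0 ∨ ∃ j < s, ∃ l ∈ Submodule.span (ZMod 2) (b '' Set.Iio j), x = b j + l := by
  induction s with
  | zero => intro x hx; left; simpa using hx
  | succ s ih =>
    intro x hx
    have : Set.Iio (s + 1) = insert s (Set.Iio s) := by
      ext i; simp only [Set.mem_Iio, Set.mem_insert_iff]; omega
    rw [this, Set.image_insert_eq, Submodule.mem_span_insert] at hx
    obtain ⟨a, z, hz, rfl⟩ := hx
    have ha : a = 0 ∨ a = 1 := by
      revert a; decide
    rcases ha with rfl | rfl
    · rcases ih z hz with h | ⟨j, hj, l, hl, h⟩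
      · left; simp [h]
      · right; exact ⟨j, by omega, l, hl, by simp [h]⟩
    · right; exact ⟨s, by omega, z, hz, by simp⟩

theorem nc_add_self {V : Type*} [AddCommGroup V] [Module (ZMod 2) V] (x : V) : x + x = 0 := by
  have h : ((1 : ZMod 2) + 1) • x = 0 := by
    rw [show ((1 : ZMod 2) + 1) = 0 from by decide, zero_smul]
  simpa [add_smul] using h

theorem nc_cyclic {V : Type*} [AddCommGroup V] [Module (ZMod 2) V] (T : Module.End (ZMod 2) V)
    (b : ℕ → V) (hT : ∀ i, T (b i) = b (i + 1)) (m : ℕ)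
    (bs : Module.Basis (Fin (m + 1)) (ZMod 2) V) (hb : ∀ i, bs i = b i) :
    ∃ e n : Module.End (ZMod 2) V, IsIdempotentElem e ∧ IsNilpotent n ∧ T = e + n := by
  have two : ∀ x : V, x + x = 0 := nc_add_self
  have hneg : ∀ x y : V, x - y = x + y := fun x y => by
    rw [sub_eq_iff_eq_add, add_assoc, two, add_zero]
  -- extensionality
  have hext : ∀ f g : Module.End (ZMod 2) V, (∀ i ≤ m, f (b i) = g (b i)) → f = g := by
    intro f g h
    refine bs.ext fun i => ?_
    rw [hb]; exact h i (by omega)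
  have hcon : ∀ w : ℕ → V, ∃ f : Module.End (ZMod 2) V, ∀ i ≤ m, f (b i) = w i := by
    intro w
    refine ⟨bs.constr (ZMod 2) (fun i => w i), fun i hi => ?_⟩
    have := bs.constr_basis (ZMod 2) (fun i : Fin (m+1) => w i) ⟨i, by omega⟩
    rwa [hb] at this
  have hspan : ∀ x : V, x ∈ Submodule.span (ZMod 2) (b '' Set.Iio (m + 1)) := by
    intro x
    have h := bs.mem_span x
    refine Submodule.span_mono ?_ h
    rintro _ ⟨i, rfl⟩
    exact ⟨i, i.2, (hb i).symm⟩
  have hpow : ∀ i k, (T ^ k) (b i) = b (i + k) := by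
    intro i k
    induction k with
    | zero => simp
    | succ k ih => rw [pow_succ', Module.End.mul_apply, ih, hT]; rfl
  rcases nc_span_top b (m + 1) _ (hspan (b (m + 1))) with h0 | ⟨j, hj, l, hl, hx⟩
  · refine ⟨0, T, by simp [IsIdempotentElem], ⟨m + 1, ?_⟩, by simp⟩
    apply hext
    intro i _
    rw [hpow, LinearMap.zero_apply, add_comm, ← hpow, h0, map_zero]
  · rcases Nat.lt_succ_iff_lt_or_eq.1 hj with hjm | rfl
    · obtain ⟨E, hE⟩ := hcon (fun i => if i < j then 0 else if i < m then b j else b m + l)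
      have hE1 : ∀ i < j, E (b i) = 0 := fun i hi => by
        rw [hE i (by omega)]; simp [hi]
      have hE2 : ∀ i, j ≤ i → i < m → E (b i) = b j := fun i hi hi' => by
        rw [hE i (by omega)]; simp [hi, hi']
      have hE3 : E (b m) = b m + l := by
        rw [hE m le_rfl]; simp [hjm.le]
      have hEl : E l = 0 := by
        have : Submodule.span (ZMod 2) (b '' Set.Iio j) ≤ LinearMap.ker E := by
          rw [Submodule.span_le]
          rintro _ ⟨i, hi, rfl⟩
          exact hE1 i hi
        exact this hl
      refine ⟨E, T - E, ?_, ⟨m + 1, ?_⟩, by abel⟩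
      · apply hext
        intro i hi
        rw [Module.End.mul_apply]
        rcases lt_or_ge i j with h | h
        · rw [hE1 i h, map_zero]
        · rcases lt_or_eq_of_le hi with h' | rfl
          · rw [hE2 i h h', hE2 j le_rfl hjm]
          · rw [hE3, map_add, hE3, hEl, add_zero]
      · set N := T - E with hN
        have N1 : ∀ i < j, N (b i) = b (i + 1) := fun i hi => by
          rw [hN, LinearMap.sub_apply, hE1 i hi, hT, sub_zero]
        have N2 : ∀ i, j ≤ i → i < m → N (b i) = b (i + 1) + b j := fun i hi hi' => by
          rw [hN, LinearMap.sub_apply, hE2 i hi hi', hT, hneg]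
        have N3 : N (b m) = b j + b m := by
          rw [hN, LinearMap.sub_apply, hE3, hT, hx, hneg]
          calc b j + l + (b m + l) = b j + b m + (l + l) := by abel
            _ = _ := by rw [two, add_zero]
        have P1 : ∀ i ≤ j, (N ^ i) (b 0) = b i := by
          intro i
          induction i with
          | zero => simp
          | succ i ih =>
            intro hi
            rw [pow_succ', Module.End.mul_apply, ih (by omega), N1 i (by omega)]
        have P2 : ∀ i, j ≤ i → i < m → (N ^ (i + 1)) (b 0) = b (i + 1) + b i := by
          intro i hi
          induction i, hi using Nat.le_induction with
          | base =>
            intro h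
            rw [pow_succ', Module.End.mul_apply, P1 j le_rfl, N2 j le_rfl h]
          | succ i hi ih =>
            intro h
            rw [pow_succ', Module.End.mul_apply, ih (by omega), map_add, N2 _ (by omega) h,
              N2 _ hi (by omega)]
            calc b (i + 1 + 1) + b j + (b (i + 1) + b j)
                = b (i + 1 + 1) + b (i + 1) + (b j + b j) := by abel
              _ = _ := by rw [two, add_zero]
        have P3 : (N ^ (m + 1)) (b 0) = 0 := by
          obtain ⟨q, rfl⟩ : ∃ q, m = q + 1 := ⟨m - 1, by omega⟩
          rw [pow_succ', Module.End.mul_apply, P2 q (by omega) (by omega), map_add, N3,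
            N2 q (by omega) (by omega)]
          rw [add_comm (b (q + 1)), two]
        have P4 : ∀ k, (N ^ (m + 1)) ((N ^ k) (b 0)) = 0 := by
          intro k
          rw [← Module.End.mul_apply, ← pow_add, add_comm, pow_add, Module.End.mul_apply, P3,
            map_zero]
        apply hext
        intro i hi
        rw [LinearMap.zero_apply]
        rcases le_total i j with h | h
        · rw [← P1 i h]; exact P4 i
        · induction i, h using Nat.le_induction with
          | base => rw [← P1 j le_rfl]; exact P4 j
          | succ i h ih =>
            have := P4 (i + 1)
            rw [P2 i h (by omega), map_add, ih (by omega), add_zero] at this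
            exact this
    · obtain ⟨E, hE⟩ := hcon (fun i => if i < j then 0 else b (j + 1))
      have hE1 : ∀ i < j, E (b i) = 0 := fun i hi => by
        rw [hE i (by omega)]; simp [hi]
      have hE3 : E (b j) = b (j + 1) := by
        rw [hE j le_rfl]; simp
      have hEl : E l = 0 := by
        have : Submodule.span (ZMod 2) (b '' Set.Iio j) ≤ LinearMap.ker E := by
          rw [Submodule.span_le]
          rintro _ ⟨i, hi, rfl⟩
          exact hE1 i hi
        exact this hl
      refine ⟨E, T - E, ?_, ⟨j + 1, ?_⟩, by abel⟩
      · apply hext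
        intro i hi
        rw [Module.End.mul_apply]
        rcases lt_or_eq_of_le hi with h' | rfl
        · rw [hE1 i h', map_zero]
        · rw [hE3, hx, map_add, hE3, hEl, add_zero, hx]
      · set N := T - E with hN
        have N1 : ∀ i < j, N (b i) = b (i + 1) := fun i hi => by
          rw [hN, LinearMap.sub_apply, hE1 i hi, hT, sub_zero]
        have N3 : N (b j) = 0 := by
          rw [hN, LinearMap.sub_apply, hE3, hT, sub_self]
        have P1 : ∀ i ≤ j, (N ^ i) (b 0) = b i := by
          intro i
          induction i with
          | zero => simp
          | succ i ih =>
            intro hi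
            rw [pow_succ', Module.End.mul_apply, ih (by omega), N1 i (by omega)]
        apply hext
        intro i hi
        rw [LinearMap.zero_apply, ← P1 i hi, ← Module.End.mul_apply, ← pow_add, add_comm, pow_add,
          Module.End.mul_apply, pow_succ', Module.End.mul_apply, P1 j le_rfl, N3, map_zero]

theorem nc_split {V : Type*} [AddCommGroup V] [Module (ZMod 2) V] (T : Module.End (ZMod 2) V)
    (W U : Submodule (ZMod 2) V) (hWU : IsCompl W U) (hW : ∀ x ∈ W, T x ∈ W)
    (ihW : ∀ T : Module.End (ZMod 2) W,
      ∃ e n : Module.End (ZMod 2) W, IsIdempotentElem e ∧ IsNilpotent n ∧ T = e + n)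
    (ihU : ∀ T : Module.End (ZMod 2) U,
      ∃ e n : Module.End (ZMod 2) U, IsIdempotentElem e ∧ IsNilpotent n ∧ T = e + n) :
    ∃ e n : Module.End (ZMod 2) V, IsIdempotentElem e ∧ IsNilpotent n ∧ T = e + n := by
  let p := W.projectionOnto U hWU
  let q := U.projectionOnto W hWU.symm
  have pW : ∀ x : W, p x = x := fun x => Submodule.projectionOnto_apply_left hWU x
  have pU : ∀ x : U, p x = 0 := fun x => Submodule.projectionOnto_apply_right hWU x
  have qU : ∀ x : U, q x = x := fun x => Submodule.projectionOnto_apply_left hWU.symm x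
  have qW : ∀ x : W, q x = 0 := fun x => Submodule.projectionOnto_apply_right hWU.symm x
  have hpq : ∀ x : V, (p x : V) + (q x : V) = x := fun x =>
    Submodule.projection_add_projection_eq_self hWU x
  obtain ⟨e, n, he, ⟨a, hn⟩, h⟩ := ihW (T.restrict hW)
  obtain ⟨e', n', he', ⟨a', hn'⟩, h'⟩ := ihU (q ∘ₗ T ∘ₗ U.subtype)
  let E : Module.End (ZMod 2) V := W.subtype ∘ₗ e ∘ₗ p + U.subtype ∘ₗ e' ∘ₗ q
  have hEx : ∀ x, E x = (e (p x) : V) + (e' (q x) : V) := fun x => rfl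
  have hpE : ∀ x, p (E x) = e (p x) := fun x => by rw [hEx, map_add, pW, pU, add_zero]
  have hqE : ∀ x, q (E x) = e' (q x) := fun x => by rw [hEx, map_add, qW, qU, zero_add]
  have hee : ∀ x, e (e x) = e x := fun x => LinearMap.congr_fun he x
  have hee' : ∀ x, e' (e' x) = e' x := fun x => LinearMap.congr_fun he' x
  let N := T - E
  have hNx : ∀ x, N x = T x - E x := fun x => rfl
  have hNW : ∀ x : W, N x = (n x : V) := by
    intro x
    have h1 : T x = (e x : V) + (n x : V) := congrArg Subtype.val (LinearMap.congr_fun h x)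
    rw [hNx, hEx, h1, pW, qW]; simp
  have hqT : ∀ x : U, q (T x) = e' x + n' x := fun x => LinearMap.congr_fun h' x
  have hqN : ∀ x, q (N x) = n' (q x) := by
    intro x
    have h1 : q (T x) = q (T (q x)) := by
      conv_lhs => rw [← hpq x, map_add, map_add]
      have : q (T (p x)) = 0 := qW ⟨T (p x), hW _ (p x).2⟩
      rw [this, zero_add]
    rw [hNx, map_sub, hqE, h1, hqT]; simp
  have hNWp : ∀ k, ∀ x : W, (N ^ k) (x : V) = ((n ^ k) x : V) := by
    intro k
    induction k with
    | zero => simp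
    | succ k ih => intro x; rw [pow_succ, Module.End.mul_apply, hNW, ih]; rfl
  have hqNp : ∀ k, ∀ x, q ((N ^ k) x) = (n' ^ k) (q x) := by
    intro k
    induction k with
    | zero => simp
    | succ k ih => intro x; rw [pow_succ, Module.End.mul_apply, ih, hqN]; rfl
  refine ⟨E, N, ?_, ⟨a + a', ?_⟩, by simp [N]⟩
  · ext x
    rw [Module.End.mul_apply, hEx (E x), hpE, hqE, hee, hee', ← hEx]
  · ext x
    rw [pow_add, Module.End.mul_apply, ← hpq ((N ^ a') x), hqNp, hn']
    simp [hNWp, hn]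

theorem nc_end (d : ℕ) : ∀ (V : Type) [AddCommGroup V] [Module (ZMod 2) V]
    [FiniteDimensional (ZMod 2) V], Module.finrank (ZMod 2) V = d →
    ∀ T : Module.End (ZMod 2) V,
    ∃ e n : Module.End (ZMod 2) V, IsIdempotentElem e ∧ IsNilpotent n ∧ T = e + n := by
  induction d using Nat.strong_induction_on with
  | _ d ih =>
    intro V _ _ _ hd T
    rcases subsingleton_or_nontrivial V with hs | hnt
    · exact ⟨0, 0, by simp [IsIdempotentElem], by simp, by ext x; exact Subsingleton.elim _ _⟩
    obtain ⟨v, hv⟩ := exists_ne (0 : V)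
    let φ : Polynomial (ZMod 2) →ₗ[ZMod 2] V :=
      (LinearMap.applyₗ v) ∘ₗ (Polynomial.aeval T).toLinearMap
    have hφ : ∀ p, φ p = (Polynomial.aeval T p) v := fun p => rfl
    by_cases hW : LinearMap.range φ = ⊤
    · have hdpos : 0 < d := hd ▸ Module.finrank_pos
      obtain ⟨m, rfl⟩ : ∃ m, d = m + 1 := ⟨d - 1, by omega⟩
      let b : ℕ → V := fun i => (T ^ i) v
      have hspan : ⊤ ≤ Submodule.span (ZMod 2) (Set.range fun i : Fin (m + 1) => b i) := by
        intro x _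
        obtain ⟨p, rfl⟩ : x ∈ LinearMap.range φ := hW ▸ Submodule.mem_top
        have hmon := T.charpoly_monic
        rw [hφ, ← Polynomial.aeval_modByMonic_eq_self_of_root T.aeval_self_charpoly]
        have hdeg : (p %ₘ T.charpoly).natDegree < m + 1 := by
          have h1 : T.charpoly.natDegree = m + 1 := by rw [LinearMap.charpoly_natDegree, hd]
          rw [← h1]
          apply Polynomial.natDegree_modByMonic_lt _ hmon
          intro h; rw [h] at h1; simp at h1
        rw [Polynomial.aeval_eq_sum_range' hdeg, LinearMap.sum_apply]
        refine Submodule.sum_mem _ fun i hi => ?_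
        rw [LinearMap.smul_apply]
        refine Submodule.smul_mem _ _ (Submodule.subset_span ⟨⟨i, by simpa using hi⟩, rfl⟩)
      refine nc_cyclic T b (fun i => ?_) m
        (basisOfTopLeSpanOfCardEqFinrank (fun i : Fin (m + 1) => b i) hspan (by simp [hd])) ?_
      · simp only [b]; rw [pow_succ', Module.End.mul_apply]
      · intro i; simp
    · obtain ⟨U, hU⟩ := Submodule.exists_isCompl (LinearMap.range φ)
      have hsum := Submodule.finrank_add_eq_of_isCompl hU
      have hvW : v ∈ LinearMap.range φ := ⟨1, by simp [hφ]⟩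
      have h1 : Module.finrank (ZMod 2) (LinearMap.range φ) < d := by
        rw [← hd]; exact Submodule.finrank_lt hW
      have h2 : 0 < Module.finrank (ZMod 2) (LinearMap.range φ) := by
        rw [Module.finrank_pos_iff_exists_ne_zero]
        exact ⟨⟨v, hvW⟩, fun h => hv (congrArg Subtype.val h)⟩
      refine nc_split T (LinearMap.range φ) U hU ?_ (ih _ h1 _ rfl) (ih _ (by omega) _ rfl)
      rintro _ ⟨p, rfl⟩
      exact ⟨Polynomial.X * p, by simp [hφ]⟩

theorem nc_matrix_two (n : ℕ) : IsNilCleanRing (Matrix (Fin n) (Fin n) (ZMod 2)) := by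
  intro A
  let ψ := (Matrix.toLinAlgEquiv' (R := ZMod 2) (n := Fin n)).symm
  obtain ⟨e, f, he, hf, h⟩ := nc_end _ (Fin n → ZMod 2) rfl (Matrix.toLinAlgEquiv' A)
  refine ⟨ψ e, ψ f, he.map ψ, hf.map ψ, ?_⟩
  rw [← map_add, ← h]; simp [ψ]

theorem matrix_zmod_two_pow_nilClean (n k : ℕ) (hn : 0 < n) (hk : 0 < k) :
    IsNilCleanRing (Matrix (Fin n) (Fin n) (ZMod (2 ^ k))) := by
  let c : ZMod (2 ^ k) →+* ZMod 2 := ZMod.castHom (dvd_pow_self 2 hk.ne') (ZMod 2)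
  have hc : Function.Surjective c := ZMod.castHom_surjective _
  let F : Matrix (Fin n) (Fin n) (ZMod (2 ^ k)) →+* Matrix (Fin n) (Fin n) (ZMod 2) := c.mapMatrix
  have hF : Function.Surjective F := by
    intro M
    choose g hg using hc
    refine ⟨M.map g, ?_⟩
    ext i j; simp [F, hg]
  have hdiv : ∀ x, c x = 0 → ∃ y, x = 2 * y := by
    intro x hx
    have : NeZero (2 ^ k) := ⟨by positivity⟩
    obtain ⟨m, rfl⟩ := ZMod.natCast_zmod_surjective x
    rw [map_natCast, ZMod.natCast_eq_zero_iff] at hx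
    obtain ⟨y, rfl⟩ := hx
    exact ⟨y, by push_cast; rfl⟩
  have hker : ∀ x ∈ RingHom.ker F, IsNilpotent x := by
    intro M hM
    have h0 : ∀ i j, c (M i j) = 0 := fun i j => congrFun (congrFun hM i) j
    choose Y hY using fun i j => hdiv _ (h0 i j)
    have hMY : M = (2 : ZMod (2 ^ k)) • Matrix.of Y := by
      ext i j; simp [hY i j]
    refine ⟨k, ?_⟩
    rw [hMY, smul_pow]
    have : (2 : ZMod (2 ^ k)) ^ k = 0 := by
      have := ZMod.natCast_self (2 ^ k)
      push_cast at this
      exact this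
    rw [this, zero_smul]
  intro A
  obtain ⟨e, f, he, hf, h⟩ := nc_matrix_two n (F A)
  obtain ⟨e', he', rfl⟩ := exists_isIdempotentElem_eq_of_ker_isNilpotent F hker e (hF e) he
  refine ⟨e', A - e', he', ?_, by abel⟩
  obtain ⟨r, hr⟩ := hf
  have h1 : F ((A - e') ^ r) = 0 := by
    rw [map_pow, map_sub, h, add_sub_cancel_left, hr]
  obtain ⟨s, hs⟩ := hker _ h1
  exact ⟨r * s, by rw [pow_mul, hs]⟩
end

section
/- If R is a Boolean ring, then for every positive integer n the matrix ring Mₙ(R) is nil-clean. -/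
/-- Nil-clean decomposition of a single element. -/
def NCel {R : Type*} [Ring R] (a : R) : Prop :=
  ∃ e n : R, IsIdempotentElem e ∧ IsNilpotent n ∧ a = e + n

section field

variable {V : Type*} [AddCommGroup V] [Module (ZMod 2) V] [Module.Finite (ZMod 2) V]

lemma zmod2_cases (a : ZMod 2) : a = 0 ∨ a = 1 := by
  revert a; decide

lemma add_self_V (x : V) : x + x = 0 := by
  have : (2 : ZMod 2) • x = 0 := by
    have h : (2 : ZMod 2) = 0 := by decide
    rw [h, zero_smul]
  rwa [two_smul] at this

lemma mem_K (N : Module.End (ZMod 2) V) (x : V) (h : N x ∈ N.maxGenEigenspace 0) :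
    x ∈ N.maxGenEigenspace 0 := by
  rw [Module.End.mem_maxGenEigenspace] at h ⊢
  obtain ⟨k, hk⟩ := h
  refine ⟨k + 1, ?_⟩
  simpa [pow_succ] using hk

lemma nilp_of_K (N : Module.End (ZMod 2) V) (h : N.maxGenEigenspace 0 = ⊤) :
    IsNilpotent N := by
  rw [Module.End.isNilpotent_iff_of_finite]
  intro x
  have hx : x ∈ N.maxGenEigenspace 0 := by rw [h]; trivial
  rw [Module.End.mem_maxGenEigenspace] at hx
  simpa using hx

lemma core (A : Module.End (ZMod 2) V) (v : V) (m : ℕ) (hm : 0 < m)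
    (φ : ℕ → V →ₗ[ZMod 2] ZMod 2)
    (hφ : ∀ i < m, ∀ j < m, φ i ((A ^ j) v) = if i = j then 1 else 0)
    (hx : ∀ x, (∀ i < m, φ i x = 0) → x = 0)
    (hspan : Submodule.span (ZMod 2) (Set.range fun i : Fin m => (A ^ (i : ℕ)) v) = ⊤) :
    NCel A := by
  have hA : ∀ j, A ((A ^ j) v) = (A ^ (j + 1)) v := by
    intro j; rw [pow_succ']; rfl
  have key : ∀ N : Module.End (ZMod 2) V,
      (∀ i < m, (A ^ i) v ∈ N.maxGenEigenspace 0) → IsNilpotent N := by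
    intro N hN
    apply nilp_of_K
    rw [eq_top_iff, ← hspan, Submodule.span_le]
    rintro _ ⟨i, rfl⟩
    exact hN i i.2
  obtain ⟨p, rfl⟩ : ∃ p, m = p + 1 := ⟨m - 1, by omega⟩
  by_cases h0 : ∀ i < p + 1, φ i ((A ^ (p + 1)) v) = 0
  · refine ⟨0, A, IsIdempotentElem.zero, ?_, by simp⟩
    have hz := hx _ h0
    apply key
    intro i hi
    rw [Module.End.mem_maxGenEigenspace]
    refine ⟨p + 1, ?_⟩
    rw [zero_smul, sub_zero, ← Module.End.mul_apply, ← pow_add, add_comm, pow_add,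
      Module.End.mul_apply, hz, map_zero]
  rcases zmod2_cases (φ p ((A ^ (p + 1)) v)) with hp | hp
  · push Not at h0
    obtain ⟨i, hi, hne⟩ := h0
    have hci : φ i ((A ^ (p + 1)) v) = 1 := (zmod2_cases _).resolve_left hne
    have hip : i < p := by
      rcases Nat.lt_succ_iff_lt_or_eq.mp hi with h | h
      · exact h
      · subst h; rw [hp] at hci; exact absurd hci (by decide)
    obtain ⟨q, rfl⟩ : ∃ q, p = q + 1 := ⟨p - 1, by omega⟩
    -- the functional f
    obtain ⟨f, hf1, hf2, hf3, hf4⟩ : ∃ f : V →ₗ[ZMod 2] ZMod 2,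
        f ((A ^ q) v) = 1 ∧ f ((A ^ (q + 1)) v) = 1 ∧
        f ((A ^ (q + 1 + 1)) v) = 1 ∧ True := by
      rcases zmod2_cases (φ q ((A ^ (q + 1 + 1)) v)) with hq | hq
      · have hiq : i ≠ q := by
          rintro rfl; rw [hq] at hci; exact absurd hci (by decide)
        refine ⟨φ q + φ (q + 1) + φ i, ?_, ?_, ?_, trivial⟩
        · simp only [LinearMap.add_apply]
          rw [hφ q (by omega) q (by omega), hφ (q+1) (by omega) q (by omega),
            hφ i (by omega) q (by omega)]
          simp [hiq]
        · simp only [LinearMap.add_apply]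
          rw [hφ q (by omega) (q+1) (by omega), hφ (q+1) (by omega) (q+1) (by omega),
            hφ i (by omega) (q+1) (by omega)]
          simp; omega
        · simp only [LinearMap.add_apply]
          rw [hq, hp, hci]; decide
      · refine ⟨φ q + φ (q + 1), ?_, ?_, ?_, trivial⟩
        · simp only [LinearMap.add_apply]
          rw [hφ q (by omega) q (by omega), hφ (q+1) (by omega) q (by omega)]
          simp
        · simp only [LinearMap.add_apply]
          rw [hφ q (by omega) (q+1) (by omega), hφ (q+1) (by omega) (q+1) (by omega)]
          simp
        · simp only [LinearMap.add_apply]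
          rw [hq, hp]; decide
    set w := (A ^ (q + 1 + 1)) v + (A ^ (q + 1)) v with hw
    have hg1 : φ (q + 1) ((A ^ q) v) = 0 := by
      rw [hφ _ (by omega) _ (by omega)]; simp
    have hg2 : φ (q + 1) ((A ^ (q + 1)) v) = 1 := by
      rw [hφ _ (by omega) _ (by omega)]; simp
    have hgw : φ (q + 1) w = 1 := by rw [hw, map_add, hp, hg2]; decide
    have hfw : f w = 0 := by rw [hw, map_add, hf2, hf3]; decide
    let E : Module.End (ZMod 2) V :=
      f.smulRight ((A ^ q) v) + (φ (q + 1)).smulRight w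
    have hE : ∀ x, E x = f x • (A ^ q) v + φ (q + 1) x • w := fun x => rfl
    refine ⟨E, A - E, ?_, ?_, by abel⟩
    · refine LinearMap.ext fun x => ?_
      rw [Module.End.mul_apply, hE (E x), hE x]
      simp only [map_add, map_smul, hf1, hfw, hg1, hgw]
      simp
    · have hN : ∀ x, (A - E) x = A x - (f x • (A ^ q) v + φ (q + 1) x • w) := fun x => rfl
      have hb : (A ^ (q + 1)) v + (A ^ q) v ∈ (A - E).maxGenEigenspace 0 := by
        apply mem_K
        rw [hN]
        simp only [map_add, hA, hf1, hf2, hg1, hg2]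
        have : (1 + 1 : ZMod 2) = 0 := by decide
        rw [this, ← hw]
        simp
      have hq0 : (A ^ q) v ∈ (A - E).maxGenEigenspace 0 := by
        apply mem_K
        rw [hN, hA, hf1, hg1]
        have : (A ^ (q + 1)) v - ((1 : ZMod 2) • (A ^ q) v + (0 : ZMod 2) • w)
          = (A ^ (q + 1)) v + (A ^ q) v := by
          rw [one_smul, zero_smul, add_zero, sub_eq_add_neg,
            neg_eq_of_add_eq_zero_left (add_self_V _)]
        rwa [this]
      have hq1 : (A ^ (q + 1)) v ∈ (A - E).maxGenEigenspace 0 := by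
        have := Submodule.sub_mem _ hb hq0
        simpa using this
      apply key
      have : ∀ d j, j + d = q → (A ^ j) v ∈ (A - E).maxGenEigenspace 0 := by
        intro d
        induction d with
        | zero => intro j hj; have : j = q := by omega
                  rw [this]; exact hq0
        | succ d ih =>
          intro j hj
          apply mem_K
          rw [hN, hA, hφ (q+1) (by omega) j (by omega), if_neg (by omega), zero_smul, add_zero]
          exact Submodule.sub_mem _ (ih (j + 1) (by omega)) (Submodule.smul_mem _ _ hq0)
      intro j hj
      by_cases hjq : j = q + 1
      · rw [hjq]; exact hq1
      · exact this (q - j) j (by omega)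
  · set w := (A ^ (p + 1)) v with hw
    let E : Module.End (ZMod 2) V := (φ p).smulRight w
    have hE : ∀ x, E x = φ p x • w := fun x => rfl
    refine ⟨E, A - E, ?_, ?_, by abel⟩
    · refine LinearMap.ext fun x => ?_
      rw [Module.End.mul_apply, hE (E x), hE x]
      simp [hp]
    · have hN : ∀ x, (A - E) x = A x - φ p x • w := fun x => rfl
      apply key
      have : ∀ d j, j + d = p → (A ^ j) v ∈ (A - E).maxGenEigenspace 0 := by
        intro d
        induction d with
        | zero =>
          intro j hj
          have : j = p := by omega
          subst this
          apply mem_K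
          rw [hN, hA, hφ j (by omega) j (by omega), if_pos rfl, one_smul, ← hw, sub_self]
          exact Submodule.zero_mem _
        | succ d ih =>
          intro j hj
          apply mem_K
          rw [hN, hA, hφ p (by omega) j (by omega), if_neg (by omega), zero_smul, sub_zero]
          exact ih (j + 1) (by omega)
      intro j hj
      exact this (p - j) j (by omega)

lemma block (A : Module.End (ZMod 2) V) (W : Submodule (ZMod 2) V) (hW : ∀ x ∈ W, A x ∈ W)
    (h1 : NCel (A.restrict hW)) (h2 : NCel (W.mapQ W A hW)) : NCel A := by
  obtain ⟨E1, N1, hE1, ⟨k, hk⟩, hA1⟩ := h1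
  obtain ⟨E2, N2, hE2, ⟨l, hl⟩, hA2⟩ := h2
  obtain ⟨s, hs⟩ := W.mkQ.exists_rightInverse_of_surjective W.range_mkQ
  have hs' : ∀ y, W.mkQ (s y) = y := fun y => LinearMap.congr_fun hs y
  let p : V →ₗ[ZMod 2] W := (LinearMap.id - s ∘ₗ W.mkQ).codRestrict W (by
    intro x
    have hker : W.mkQ ((LinearMap.id - s ∘ₗ W.mkQ : V →ₗ[ZMod 2] V) x) = 0 := by
      simp only [LinearMap.sub_apply, LinearMap.comp_apply, LinearMap.id_apply, map_sub, hs',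
        sub_self]
    simpa only [Submodule.mkQ_apply, Submodule.Quotient.mk_eq_zero] using hker)
  have hp : ∀ x, (p x : V) = x - s (W.mkQ x) := fun x => rfl
  have hmk : ∀ x : W, W.mkQ (x : V) = 0 := fun x => by simp
  have hp1 : ∀ x : W, p x = x := fun x => by
    apply Subtype.ext; rw [hp, hmk, map_zero, sub_zero]
  have hp2 : ∀ y, p (s y) = 0 := fun y => by
    apply Subtype.ext; rw [hp, hs', sub_self]; rfl
  let E : Module.End (ZMod 2) V := W.subtype ∘ₗ E1 ∘ₗ p + s ∘ₗ E2 ∘ₗ W.mkQ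
  have hE : ∀ x, E x = (E1 (p x) : V) + s (E2 (W.mkQ x)) := fun x => rfl
  have hE1' : ∀ x, E1 (E1 x) = E1 x := fun x => LinearMap.congr_fun hE1 x
  have hE2' : ∀ x, E2 (E2 x) = E2 x := fun x => LinearMap.congr_fun hE2 x
  have hNW : ∀ x : W, (A - E) x = (N1 x : V) := by
    intro x
    have : A x = ((A.restrict hW) x : V) := rfl
    rw [LinearMap.sub_apply, this, hA1, hE, hp1, hmk]
    simp
  have hNQ : ∀ x, W.mkQ ((A - E) x) = N2 (W.mkQ x) := by
    intro x
    have : W.mkQ (A x) = (W.mapQ W A hW) (W.mkQ x) := rfl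
    rw [LinearMap.sub_apply, map_sub, this, hA2, hE, map_add, hmk, hs']
    simp
  have hNW' : ∀ j, ∀ x : W, ((A - E) ^ j) (x : V) = ((N1 ^ j) x : V) := by
    intro j
    induction j with
    | zero => intro x; rfl
    | succ j ih => intro x; rw [pow_succ, pow_succ, Module.End.mul_apply, hNW, ih]; rfl
  have hNQ' : ∀ j, ∀ x, W.mkQ (((A - E) ^ j) x) = (N2 ^ j) (W.mkQ x) := by
    intro j
    induction j with
    | zero => intro x; rfl
    | succ j ih => intro x; rw [pow_succ', pow_succ', Module.End.mul_apply, hNQ, ih]; rfl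
  refine ⟨E, A - E, ?_, ⟨k + l, ?_⟩, by abel⟩
  · refine LinearMap.ext fun x => ?_
    rw [Module.End.mul_apply, hE (E x), hE x]
    rw [map_add p, map_add W.mkQ, hp1, hp2, hmk, hs', add_zero, zero_add, hE1', hE2']
  · refine LinearMap.ext fun x => ?_
    rw [pow_add, Module.End.mul_apply]
    have h := hNQ' l x
    rw [hl, LinearMap.zero_apply] at h
    have hm : ((A - E) ^ l) x ∈ W := by
      rw [← Submodule.ker_mkQ W]; exact h
    have := hNW' k ⟨_, hm⟩
    rw [hk] at this
    exact this

end field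

lemma end_nc : ∀ (d : ℕ) (V : Type) [AddCommGroup V] [Module (ZMod 2) V]
    [Module.Finite (ZMod 2) V] (_ : Module.finrank (ZMod 2) V = d)
    (A : Module.End (ZMod 2) V), NCel A := by
  intro d
  induction d using Nat.strong_induction_on with
  | _ d ih =>
  intro V _ _ _ hd A
  rcases subsingleton_or_nontrivial V with hV | hV
  · exact ⟨0, A, IsIdempotentElem.zero, ⟨1, Subsingleton.elim _ _⟩, by simp⟩
  obtain ⟨v, hv⟩ := exists_ne (0 : V)
  let U : ℕ → Submodule (ZMod 2) V := fun m =>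
    Submodule.span (ZMod 2) (Set.range fun i : Fin m => (A ^ (i : ℕ)) v)
  have hli : ∀ m, (∀ j < m, (A ^ j) v ∉ U j) →
      LinearIndependent (ZMod 2) (fun i : Fin m => (A ^ (i : ℕ)) v) := by
    intro m
    induction m with
    | zero => intro _; exact linearIndependent_empty_type
    | succ m ihm =>
      intro h
      rw [linearIndependent_finSucc']
      refine ⟨ihm fun j hj => h j (by omega), h m (by omega)⟩
  have hex : ∃ m, (A ^ m) v ∈ U m := by
    by_contra hcon
    push Not at hcon
    have := (hli (d + 1) fun j _ => hcon j).fintype_card_le_finrank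
    simp at this
    omega
  classical
  let m := Nat.find hex
  have hm : (A ^ m) v ∈ U m := Nat.find_spec hex
  have hmin : ∀ j < m, (A ^ j) v ∉ U j := fun j hj => Nat.find_min hex hj
  have hm0 : 0 < m := by
    rcases Nat.eq_zero_or_pos m with h | h
    · exfalso
      rw [h] at hm
      simp [U] at hm
      exact hv hm
    · exact h
  have hind := hli m hmin
  have hinv : ∀ x ∈ U m, A x ∈ U m := by
    have : U m ≤ (U m).comap A := by
      rw [Submodule.span_le]
      rintro _ ⟨i, rfl⟩
      change A ((A ^ (i : ℕ)) v) ∈ U m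
      rw [← Module.End.mul_apply, ← pow_succ']
      by_cases hi : (i : ℕ) + 1 = m
      · rw [hi]; exact hm
      · exact Submodule.subset_span ⟨⟨i + 1, by omega⟩, rfl⟩
    exact this
  by_cases htop : U m = ⊤
  · let b := Module.Basis.mk hind htop.ge
    have hb : ∀ i : Fin m, b i = (A ^ (i : ℕ)) v := fun i => by simp [b]
    refine core A v m hm0 (fun i => if h : i < m then b.coord ⟨i, h⟩ else 0) ?_ ?_ htop
    · intro i hi j hj
      rw [dif_pos hi, ← hb ⟨j, hj⟩]
      simp [Finsupp.single_apply, eq_comm]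
    · intro x hx
      apply b.ext_elem
      intro i
      have := hx i i.2
      rw [dif_pos i.2] at this
      simpa using this
  · have hne : U m ≠ ⊥ := by
      intro h
      have : (A ^ 0) v ∈ U m := Submodule.subset_span ⟨⟨0, hm0⟩, rfl⟩
      rw [h] at this
      exact hv (by simpa using this)
    apply block A (U m) hinv
    · exact ih _ (hd ▸ Submodule.finrank_lt htop) _ rfl _
    · refine ih _ ?_ _ rfl _
      have h1 := (U m).finrank_quotient_add_finrank
      have h2 : 0 < Module.finrank (ZMod 2) (U m) := by
        rw [Nat.pos_iff_ne_zero, Ne, Submodule.finrank_eq_zero]; exact hne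
      omega

lemma NCel.map {R S : Type*} [Ring R] [Ring S] (f : R →+* S) {a : R} (h : NCel a) :
    NCel (f a) := by
  obtain ⟨e, n, he, hn, rfl⟩ := h
  exact ⟨f e, f n, he.map f, hn.map f, map_add f e n⟩

lemma mat2_nc (n : ℕ) (A : Matrix (Fin n) (Fin n) (ZMod 2)) : NCel A := by
  have h := end_nc _ (Fin n → ZMod 2) rfl (Matrix.toLinAlgEquiv' A)
  have := h.map ((Matrix.toLinAlgEquiv' (R := ZMod 2) (n := Fin n)).symm.toRingEquiv.toRingHom)
  simpa using this

/-- Matrices over a finite power of the two-element field. -/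
lemma matpi_nc (n : ℕ) {ι : Type} [Finite ι] (A : Matrix (Fin n) (Fin n) (ι → ZMod 2)) :
    NCel A := by
  have h : ∀ t : ι, NCel (A.map fun f => f t) := fun t => mat2_nc n _
  choose E N hE hN hA using h
  choose k hk using hN
  obtain ⟨K, hK⟩ := (Set.finite_range k).bddAbove
  refine ⟨Matrix.of fun i j t => E t i j, Matrix.of fun i j t => N t i j, ?_, ⟨K, ?_⟩, ?_⟩
  · ext i j t
    have := congrFun (congrFun (hE t) i) j
    simpa [Matrix.mul_apply] using this
  · ext i j t
    have h1 : N t ^ K = 0 := pow_eq_zero_of_le (hK ⟨t, rfl⟩) (hk t)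
    have h2 := congrArg (fun M => M i j)
      (map_pow (Pi.evalRingHom (fun _ : ι => ZMod 2) t).mapMatrix
        (Matrix.of fun i j t => N t i j) K)
    have h3 : (Pi.evalRingHom (fun _ : ι => ZMod 2) t).mapMatrix
        (Matrix.of fun i j t => N t i j) = N t := by ext; rfl
    rw [h3, h1] at h2
    exact h2
  · ext i j t
    exact congrFun (congrFun (hA t) i) j

/-- Finitely many elements of a Boolean ring lie in the image of a finite power of `ZMod 2`. -/
lemma bool_hom {R : Type*} [CommRing R] [CharP R 2] (hbool : ∀ a : R, a * a = a)
    {κ : Type} [Fintype κ] [DecidableEq κ] (a : κ → R) :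
    ∃ φ : ((κ → ZMod 2) → ZMod 2) →+* R, ∀ k, φ (fun B => B k) = a k := by
  let c : ZMod 2 →+* R := ZMod.castHom (dvd_refl 2) R
  let g : κ → ZMod 2 → R := fun k b => a k + 1 + c b
  let e : (κ → ZMod 2) → R := fun B => ∏ k, g k (B k)
  have h2 : (2 : R) = 0 := CharTwo.two_eq_zero
  have hu : (Finset.univ : Finset (ZMod 2)) = {0, 1} := by decide
  have hsum : ∑ B, e B = 1 := by
    have : ∏ k, ∑ b, g k b = ∑ B : κ → ZMod 2, ∏ k, g k (B k) := by
      rw [Finset.prod_univ_sum, Fintype.piFinset_univ]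
    rw [← this]
    apply Finset.prod_eq_one
    intro k _
    rw [hu, Finset.sum_pair (by decide)]
    simp only [g, map_zero, map_one]
    linear_combination (a k + 1) * h2
  have horth : ∀ B C, B ≠ C → e B * e C = 0 := by
    intro B C hBC
    obtain ⟨k, hk⟩ := Function.ne_iff.mp hBC
    simp only [e]
    rw [← Finset.prod_mul_distrib]
    apply Finset.prod_eq_zero (Finset.mem_univ k)
    simp only [g]
    rcases zmod2_cases (B k) with h | h <;> rcases zmod2_cases (C k) with h' | h' <;>
      rw [h, h'] at hk ⊢
    · exact absurd rfl hk
    · rw [map_zero, map_one]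
      linear_combination hbool (a k) + (2 * a k + 1) * h2
    · rw [map_zero, map_one]
      linear_combination hbool (a k) + (2 * a k + 1) * h2
    · exact absurd rfl hk
  have hea : ∀ B k, c (B k) * e B = a k * e B := by
    intro B k
    simp only [e]
    rw [← Finset.mul_prod_erase Finset.univ (fun k => g k (B k)) (Finset.mem_univ k),
      ← mul_assoc, ← mul_assoc]
    congr 1
    simp only [g]
    rcases zmod2_cases (B k) with h | h <;> rw [h]
    · rw [map_zero]
      linear_combination - hbool (a k) - a k * h2
    · rw [map_one]
      linear_combination - hbool (a k) + (1 - a k) * h2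
  refine ⟨{ toFun := fun f => ∑ B, c (f B) * e B
            map_one' := by simp [hsum]
            map_zero' := by simp
            map_add' := fun f g => by simp [add_mul, Finset.sum_add_distrib]
            map_mul' := fun f g => ?_ }, ?_⟩
  · rw [Finset.sum_mul_sum]
    apply Finset.sum_congr rfl
    intro B _
    rw [Finset.sum_eq_single B]
    · rw [Pi.mul_apply, map_mul]
      linear_combination - c (f B) * c (g B) * hbool (e B)
    · intro C _ hC
      linear_combination c (f B) * c (g C) * horth B C hC.symm
    · simp
  · intro k
    change ∑ B, c (B k) * e B = a k
    simp only [hea]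
    rw [← Finset.mul_sum, hsum, mul_one]

theorem matrix_nilClean_of_boolean (R : Type*) [Ring R] (hbool : ∀ a : R, a * a = a)
    (n : ℕ) (hn : 0 < n) :
    IsNilCleanRing (Matrix (Fin n) (Fin n) R) := by
  intro M
  rcases subsingleton_or_nontrivial R with hR | hR
  · exact ⟨0, 0, IsIdempotentElem.zero, IsNilpotent.zero, Subsingleton.elim _ _⟩
  have h2 : (2 : R) = 0 := by
    have h := hbool 2
    have h' : (2 : R) * 2 = 2 + 2 := mul_two 2
    rw [h'] at h
    exact left_eq_add.mp h.symm
  have hcomm : ∀ a b : R, a * b = b * a := by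
    intro a b
    have h := hbool (a + b)
    rw [add_mul, mul_add, mul_add, hbool, hbool] at h
    have h3 : a * b + b * a = 0 := by
      have : a * b + b * a = (a + a * b + (b * a + b)) - (a + b) := by abel
      rw [this, h, sub_self]
    have h4 : b * a + b * a = 0 := by rw [← two_mul, h2, zero_mul]
    exact add_right_cancel (h3.trans h4.symm)
  let _ : CommRing R := { ‹Ring R› with mul_comm := hcomm }
  have : CharP R 2 := CharTwo.of_one_ne_zero_of_two_eq_zero one_ne_zero h2
  obtain ⟨φ, hφ⟩ := bool_hom hbool (fun k : Fin n × Fin n => M k.1 k.2)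
  have h := (matpi_nc n (Matrix.of fun i j => fun B : Fin n × Fin n → ZMod 2 => B (i, j))).map
    φ.mapMatrix
  have hM : φ.mapMatrix
      (Matrix.of fun i j => fun B : Fin n × Fin n → ZMod 2 => B (i, j)) = M := by
    ext i j
    exact hφ (i, j)
  rw [hM] at h
  exact h
end

section
/- If G is a finite abelian 2-group (a finite abelian group whose order is a power of 2), then the endomorphism ring End(G) is nil-clean. -/
/-- Nil-clean element. -/
def NCElem {R : Type*} [Ring R] (a : R) : Prop :=
  ∃ e n : R, IsIdempotentElem e ∧ IsNilpotent n ∧ a = e + n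

/-- A shift-like operator is nilpotent. -/
lemma nilp_of_shift {K V : Type*} [Field K] [AddCommGroup V] [Module K V]
    (N : Module.End K V) (m : ℕ) (b : ℕ → V) (hs : ∀ k < m, N (b k) = b (k+1))
    (hl : N (b m) = 0) (hspan : ∀ S : Submodule K V, (∀ k ≤ m, b k ∈ S) → S = ⊤) :
    IsNilpotent N := by
  have h1 : ∀ k ≤ m, (N ^ k) (b 0) = b k := by
    intro k
    induction k with
    | zero => intro _; simp
    | succ k ih =>
      intro hk
      rw [pow_succ', Module.End.mul_apply, ih (by omega), hs k (by omega)]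
  have h2 : (N ^ (m+1)) (b 0) = 0 := by
    rw [pow_succ', Module.End.mul_apply, h1 m le_rfl, hl]
  refine ⟨m+1, ?_⟩
  have := hspan (LinearMap.ker (N^(m+1))) (by
    intro k hk
    rw [LinearMap.mem_ker, ← h1 k hk, ← Module.End.mul_apply, ← pow_add, add_comm, pow_add,
      Module.End.mul_apply, h2, map_zero])
  exact LinearMap.ker_eq_top.mp this

lemma core_s14 {K V : Type*} [Field K] [AddCommGroup V] [Module K V]
    (h01 : ∀ x : K, x = 0 ∨ x = 1) (a : Module.End K V) (v : V) (m : ℕ)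
    (b : Module.Basis (Fin (m+1)) K V) (hb : ∀ i, b i = (a ^ (i:ℕ)) v)
    (ha : Function.Surjective a) (ha1 : Function.Surjective (a - 1 : Module.End K V)) : NCElem a := by
  classical
  have h2 : (1:K) + 1 = 0 := by
    rcases h01 (1+1) with h | h
    · exact h
    · simp at h
  have hneg : (-1:K) = 1 := by linear_combination -h2
  obtain ⟨w, hw⟩ : ∃ w : ℕ → V, ∀ k, w k = (a ^ k) v := ⟨_, fun _ => rfl⟩
  have haw : ∀ k, a (w k) = w (k+1) := by
    intro k; rw [hw, hw, pow_succ', Module.End.mul_apply]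
  have hbw : ∀ i : Fin (m+1), b i = w i := fun i => by rw [hb, hw]
  have hwb : ∀ k (hk : k < m+1), w k = b ⟨k, hk⟩ := fun k hk => by rw [hbw]
  have hspan : ∀ S : Submodule K V, (∀ k ≤ m, w k ∈ S) → S = ⊤ := by
    intro S hS
    rw [eq_top_iff, ← b.span_eq, Submodule.span_le]
    rintro _ ⟨i, rfl⟩
    rw [hbw]
    exact hS _ (by have := i.2; omega)
  obtain ⟨ψ, hψ⟩ : ∃ ψ : V →ₗ[K] K, ∀ k ≤ m, ψ (w k) = if k = m then 1 else 0 := by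
    refine ⟨b.coord (Fin.last m), fun k hk => ?_⟩
    rw [hwb k (by omega), Module.Basis.coord_apply, Module.Basis.repr_self, Finsupp.single_apply]
    simp [Fin.ext_iff]
  obtain ⟨c, hc⟩ : ∃ c : V →ₗ[K] K, ∀ k ≤ m, c (w k) = if k = 0 then 1 else 0 := by
    refine ⟨b.coord 0, fun k hk => ?_⟩
    rw [hwb k (by omega), Module.Basis.coord_apply, Module.Basis.repr_self, Finsupp.single_apply]
    simp [Fin.ext_iff]
  obtain ⟨σ, hσ, hσm⟩ : ∃ σ : V →ₗ[K] K, (∀ k ≤ m, σ (w k) = 1) ∧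
      (m = 0 → σ = c) ∧ (m = 1 → σ = c + ψ) := by
    have key : ∀ k ≤ m, (b.constr K (fun _ => (1:K))) (w k) = 1 := by
      intro k hk
      rw [hwb k (by omega), Module.Basis.constr_basis]
    refine ⟨b.constr K (fun _ => (1:K)), key, ?_, ?_⟩
    · rintro rfl
      refine b.ext fun i => ?_
      rw [hbw, key _ (by omega), hc _ (by omega), if_pos (by omega)]
    · rintro rfl
      refine b.ext fun i => ?_
      rw [hbw, key _ (by omega), LinearMap.add_apply, hc _ (by omega), hψ _ (by omega)]
      have : (i:ℕ) = 0 ∨ (i:ℕ) = 1 := by omega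
      rcases this with h | h <;> simp [h]
  have hcn : c (w (m+1)) = 1 := by
    refine (h01 _).resolve_left fun h => ?_
    have : LinearMap.ker (c ∘ₗ a) = ⊤ := hspan _ (by
      intro k hk
      rw [LinearMap.mem_ker, LinearMap.comp_apply, haw]
      rcases hk.lt_or_eq with hk | rfl
      · rw [hc _ (by omega), if_neg (by omega)]
      · exact h)
    obtain ⟨x, hx⟩ := ha (w 0)
    have h3 : x ∈ LinearMap.ker (c ∘ₗ a) := this ▸ Submodule.mem_top
    rw [LinearMap.mem_ker, LinearMap.comp_apply, hx, hc 0 (by omega)] at h3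
    simp at h3
  have hσn : σ (w (m+1)) = 0 := by
    refine (h01 _).resolve_right fun h => ?_
    have : LinearMap.ker (σ ∘ₗ (a-1)) = ⊤ := hspan _ (by
      intro k hk
      rw [LinearMap.mem_ker, LinearMap.comp_apply, LinearMap.sub_apply, haw, Module.End.one_apply,
        map_sub, hσ k hk]
      rcases hk.lt_or_eq with hk | rfl
      · rw [hσ _ (by omega), sub_self]
      · rw [h, sub_self])
    obtain ⟨x, hx⟩ := ha1 (w 0)
    have h3 : x ∈ LinearMap.ker (σ ∘ₗ (a-1)) := this ▸ Submodule.mem_top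
    rw [LinearMap.mem_ker, LinearMap.comp_apply, hx, hσ 0 (by omega)] at h3
    simp at h3
  rcases h01 (ψ (w (m+1))) with ht | ht
  · -- trace zero
    have hm0 : m ≠ 0 := fun h => by
      rw [hσm.1 h, hcn] at hσn; simp at hσn
    have hm1 : m ≠ 1 := fun h => by
      rw [hσm.2 h, LinearMap.add_apply, hcn, ht] at hσn; simp at hσn
    obtain ⟨φ, hφ⟩ : ∃ φ : V →ₗ[K] K, ∀ x, φ x = σ x - c x := ⟨σ - c, fun _ => rfl⟩
    have hφ1 : ∀ k, 1 ≤ k → k ≤ m + 1 → φ (w k) = 1 := by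
      intro k h1 hk
      rcases hk.lt_or_eq with hk | rfl
      · rw [hφ, hσ k (by omega), hc k (by omega), if_neg (by omega), sub_zero]
      · rw [hφ, hσn, hcn, zero_sub, hneg]
    have hφ0 : φ (w 0) = 0 := by rw [hφ, hσ 0 (by omega), hc 0 (by omega)]; simp
    obtain ⟨E, hE⟩ : ∃ E : Module.End K V, ∀ x, E x = φ x • w 1 + ψ x • (w (m+1) - w m) :=
      ⟨φ.smulRight (w 1) + ψ.smulRight (w (m+1) - w m), fun x => rfl⟩
    refine ⟨E, a - E, ?_, ?_, by abel⟩
    · ext x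
      rw [Module.End.mul_apply, hE x, map_add, map_smul, map_smul, hE (w 1), hE (w (m+1) - w m),
        map_sub, map_sub, hφ1 1 (by omega) (by omega), hφ1 m (by omega) (by omega),
        hφ1 (m+1) (by omega) (by omega), ht, hψ 1 (by omega), hψ m le_rfl, if_neg (by omega),
        if_pos rfl, zero_sub, hneg]
      simp
    · obtain ⟨β, hβ⟩ : ∃ β : ℕ → V, ∀ k, β k = if k ≤ 1 then w k else w k - w (k-1) :=
        ⟨_, fun _ => rfl⟩
      have hEβ : ∀ k, 2 ≤ k → k < m → E (β k) = 0 := by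
        intro k h1 hk
        rw [hβ, if_neg (by omega), hE, map_sub, map_sub, hφ1 _ (by omega) (by omega),
          hφ1 _ (by omega) (by omega), hψ _ (by omega), hψ _ (by omega), if_neg (by omega),
          if_neg (by omega)]
        simp
      refine nilp_of_shift _ m β ?_ ?_ ?_
      · intro k hk
        rw [LinearMap.sub_apply]
        rcases Nat.lt_or_ge k 2 with h | h
        · have : k = 0 ∨ k = 1 := by omega
          rcases this with rfl | rfl
          · rw [hβ, hβ, if_pos (by omega), if_pos (by omega), haw, hE, hφ0, hψ 0 (by omega),
              if_neg (by omega)]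
            simp
          · rw [hβ, hβ, if_pos (by omega), if_neg (by omega), haw, hE, hφ1 1 (by omega) (by omega),
              hψ 1 (by omega), if_neg (by omega)]
            simp
        · rw [hEβ k h hk, hβ, hβ, if_neg (by omega), if_neg (by omega), map_sub, haw, haw, sub_zero]
          congr 2; omega
      · rw [LinearMap.sub_apply, hβ, if_neg (by omega), hE, map_sub, map_sub, map_sub, haw, haw,
          hφ1 _ (by omega) (by omega),
          hφ1 _ (by omega) (by omega), hψ _ (by omega), hψ _ (by omega), if_pos rfl,
          if_neg (by omega), show m - 1 + 1 = m by omega]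
        simp
      · intro S hS
        refine hspan S fun k => ?_
        induction k with
        | zero => intro _; simpa [hβ] using hS 0 (by omega)
        | succ k ih =>
          intro hk
          have h3 := hS (k+1) hk
          rw [hβ] at h3
          split_ifs at h3 with h4
          · exact h3
          · have := S.add_mem h3 (ih (by omega))
            simpa using this
  · obtain ⟨E, hE⟩ : ∃ E : Module.End K V, ∀ x, E x = ψ x • w (m+1) :=
      ⟨ψ.smulRight (w (m+1)), fun x => rfl⟩
    refine ⟨E, a - E, ?_, ?_, by abel⟩
    · ext x
      rw [Module.End.mul_apply, hE x, map_smul, hE, ht, one_smul]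
    · refine nilp_of_shift _ m w ?_ ?_ hspan
      · intro k hk
        rw [LinearMap.sub_apply, haw, hE, hψ k hk.le, if_neg hk.ne]; simp
      · rw [LinearMap.sub_apply, haw, hE, hψ m le_rfl]; simp

lemma exists_cyc {K V : Type*} [Field K] [AddCommGroup V] [Module K V] [FiniteDimensional K V]
    (a : Module.End K V) (v : V) (hv : v ≠ 0)
    (hirr : ∀ W : Submodule K V, (∀ x ∈ W, a x ∈ W) → W = ⊥ ∨ W = ⊤) :
    ∃ m, ∃ b : Module.Basis (Fin (m+1)) K V, ∀ i, b i = (a ^ (i:ℕ)) v := by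
  classical
  let f : ∀ n : ℕ, Fin n → V := fun n i => (a ^ (i:ℕ)) v
  have hex : ∃ n, (a^n) v ∈ Submodule.span K (Set.range (f n)) := by
    by_contra! hcon
    have hli : ∀ n, LinearIndependent K (f n) := by
      intro n
      induction n with
      | zero => exact linearIndependent_empty_type
      | succ n ih => exact linearIndependent_finSucc'.2 ⟨ih, hcon n⟩
    have := (hli (Module.finrank K V + 1)).fintype_card_le_finrank
    simp at this
  have hli : ∀ n ≤ Nat.find hex, LinearIndependent K (f n) := by
    intro n
    induction n with
    | zero => intro _; exact linearIndependent_empty_type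
    | succ n ih => intro hn; exact linearIndependent_finSucc'.2 ⟨ih (by omega), Nat.find_min hex hn⟩
  have hsp := Nat.find_spec hex
  obtain ⟨m, hm⟩ : ∃ m, Nat.find hex = m + 1 := by
    refine Nat.exists_eq_succ_of_ne_zero fun h => ?_
    rw [h] at hsp
    simp at hsp
    exact hv hsp
  rw [hm] at hsp
  have htop : Submodule.span K (Set.range (f (m+1))) = ⊤ := by
    refine (hirr _ ?_).resolve_left ?_
    · intro x hx
      have : Submodule.span K (Set.range (f (m+1))) ≤ (Submodule.span K (Set.range (f (m+1)))).comap a := by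
        rw [Submodule.span_le]
        rintro _ ⟨i, rfl⟩
        simp only [SetLike.mem_coe, Submodule.mem_comap]
        have h4 : a (f (m+1) i) = (a ^ ((i:ℕ)+1)) v := by
          rw [pow_succ', Module.End.mul_apply]
        rw [h4]
        have := i.2
        rcases (show (i:ℕ) + 1 ≤ m + 1 by omega).lt_or_eq with h | h
        · exact Submodule.subset_span ⟨⟨i+1, h⟩, rfl⟩
        · rw [h]; exact hsp
      exact this hx
    · intro h
      rw [Submodule.span_eq_bot] at h
      exact hv (by simpa [f] using h _ ⟨0, rfl⟩)
  refine ⟨m, Module.Basis.mk (hli (m+1) hm.ge) htop.ge, fun i => ?_⟩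
  simp [f]

lemma irr {K V : Type*} [Field K] [AddCommGroup V] [Module K V] [FiniteDimensional K V]
    (h01 : ∀ x : K, x = 0 ∨ x = 1) (a : Module.End K V)
    (hirr : ∀ W : Submodule K V, (∀ x ∈ W, a x ∈ W) → W = ⊥ ∨ W = ⊤) : NCElem a := by
  have h1 := hirr (LinearMap.range a) (fun x _ => ⟨x, rfl⟩)
  have h2 := hirr (LinearMap.range (a-1)) (by
    rintro _ ⟨y, rfl⟩
    exact ⟨a y, by simp⟩)
  rcases h1 with h1 | h1
  · rw [LinearMap.range_eq_bot] at h1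
    exact ⟨0, 0, .zero, .zero, by simpa using h1⟩
  rcases h2 with h2 | h2
  · rw [LinearMap.range_eq_bot] at h2
    exact ⟨1, 0, .one, .zero, by simpa using sub_eq_zero.1 h2⟩
  rcases subsingleton_or_nontrivial V with h | h
  · exact ⟨0, 0, .zero, .zero, Subsingleton.elim _ _⟩
  obtain ⟨v, hv⟩ := exists_ne (0:V)
  obtain ⟨m, b, hb⟩ := exists_cyc a v hv hirr
  exact core_s14 h01 a v m b hb (LinearMap.range_eq_top.1 h1) (LinearMap.range_eq_top.1 h2)

lemma end_nc_s14 {K : Type*} [Field K] (h01 : ∀ x : K, x = 0 ∨ x = 1) (n : ℕ) :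
    ∀ (V : Type*) [AddCommGroup V] [Module K V] [FiniteDimensional K V]
    (_ : Module.finrank K V = n) (a : Module.End K V), NCElem a := by
  induction n using Nat.strong_induction_on with
  | _ n ih =>
  intro V _ _ _ hn a
  by_cases hirr : ∀ W : Submodule K V, (∀ x ∈ W, a x ∈ W) → W = ⊥ ∨ W = ⊤
  · exact irr h01 a hirr
  push Not at hirr
  obtain ⟨W, hW, hb, ht⟩ := hirr
  obtain ⟨U, hU⟩ := W.exists_isCompl
  have hlt : Module.finrank K W < n := hn ▸ Submodule.finrank_lt ht
  have hltU : Module.finrank K U < n := by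
    refine hn ▸ Submodule.finrank_lt fun h => hb ?_
    have := hU.disjoint
    rwa [h, disjoint_top] at this
  obtain ⟨π, hπW, hπU⟩ : ∃ π : V →ₗ[K] W, (∀ x : W, π x = x) ∧ ∀ x : U, π x = 0 :=
    ⟨W.projectionOnto U hU, by simp, by simp⟩
  obtain ⟨ρ, hρU, hρW⟩ : ∃ π : V →ₗ[K] U, (∀ x : U, π x = x) ∧ ∀ x : W, π x = 0 :=
    ⟨U.projectionOnto W hU.symm, by simp, by simp⟩
  have hdec : ∀ x : V, x = π x + ρ x := by
    intro x
    obtain ⟨y, z, rfl⟩ : ∃ y : W, ∃ z : U, (y : V) + z = x := by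
      have : x ∈ W ⊔ U := by rw [hU.sup_eq_top]; trivial
      obtain ⟨y, hy, z, hz, h⟩ := Submodule.mem_sup.1 this
      exact ⟨⟨y, hy⟩, ⟨z, hz⟩, h⟩
    simp [hπW, hπU, hρU, hρW]
  obtain ⟨e1, n1, he1, ⟨k1, hk1⟩, h1⟩ := ih _ hlt W rfl (π ∘ₗ a ∘ₗ W.subtype)
  obtain ⟨e2, n2, he2, ⟨k2, hk2⟩, h2⟩ := ih _ hltU U rfl (ρ ∘ₗ a ∘ₗ U.subtype)
  obtain ⟨E, hE⟩ : ∃ E : Module.End K V, ∀ x, E x = e1 (π x) + e2 (ρ x) :=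
    ⟨W.subtype ∘ₗ e1 ∘ₗ π + U.subtype ∘ₗ e2 ∘ₗ ρ, fun x => rfl⟩
  refine ⟨E, a - E, ?_, ?_, by abel⟩
  · ext x
    have h5 : ∀ y, e1 (e1 y) = e1 y := fun y => by rw [← Module.End.mul_apply, he1.eq]
    have h6 : ∀ y, e2 (e2 y) = e2 y := fun y => by rw [← Module.End.mul_apply, he2.eq]
    rw [Module.End.mul_apply, hE x, map_add, hE, hE]
    simp [hπW, hπU, hρU, hρW, h5, h6]
  · obtain ⟨N, hN⟩ : ∃ N, N = a - E := ⟨_, rfl⟩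
    rw [← hN]
    have hNW : ∀ x : W, N x = n1 x := by
      intro x
      have h7 : n1 x = π (a x) - e1 x := by
        have := LinearMap.congr_fun h1 x
        simp only [LinearMap.comp_apply, Submodule.subtype_apply, LinearMap.add_apply] at this
        rw [this]; abel
      have h8 : (π (a x) : V) = a x := by
        have := hπW ⟨a x, hW _ x.2⟩
        exact congrArg Subtype.val this
      rw [hN, LinearMap.sub_apply, hE, h7, hπW, hρW]
      simp [h8]
    have hNW' : ∀ k (x : W), (N^k) x = (n1^k) x := by
      intro k
      induction k with
      | zero => simp
      | succ k ihk =>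
        intro x
        rw [pow_succ', pow_succ', Module.End.mul_apply, Module.End.mul_apply, ihk, hNW]
    have hNU : ∀ x, ρ (N x) = n2 (ρ x) := by
      intro x
      have h7 : n2 (ρ x) = ρ (a (ρ x)) - e2 (ρ x) := by
        have := LinearMap.congr_fun h2 (ρ x)
        simp only [LinearMap.comp_apply, Submodule.subtype_apply, LinearMap.add_apply] at this
        rw [this]; abel
      have h8 : ρ (a x) = ρ (a (ρ x)) := by
        conv_lhs => rw [hdec x]
        rw [map_add, map_add]
        have := hρW ⟨a (π x), hW _ (π x).2⟩
        simp only at this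
        rw [this, zero_add]
      rw [h7, hN, LinearMap.sub_apply, hE, map_sub, map_add, hρU, hρW, h8, zero_add]
    have hNU' : ∀ k x, ρ ((N^k) x) = (n2^k) (ρ x) := by
      intro k
      induction k with
      | zero => simp
      | succ k ihk =>
        intro x
        rw [pow_succ', pow_succ', Module.End.mul_apply, Module.End.mul_apply, hNU, ihk]
    refine ⟨k1 + k2, ?_⟩
    ext x
    have h9 : (N^k2) x = π ((N^k2) x) := by
      conv_lhs => rw [hdec ((N^k2) x)]
      rw [hNU', hk2]; simp
    rw [pow_add, Module.End.mul_apply, h9, hNW', hk1]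
    simp

lemma nc_of_hom {R S : Type*} [Ring R] [Ring S] (f : R →+* S) (hf : Function.Surjective f)
    (hk : ∀ x ∈ RingHom.ker f, IsNilpotent x) (hS : IsNilCleanRing S) : IsNilCleanRing R := by
  intro a
  obtain ⟨e, n, he, ⟨k, hn⟩, h⟩ := hS (f a)
  obtain ⟨e', he', hfe⟩ := exists_isIdempotentElem_eq_of_ker_isNilpotent f hk e (hf e) he
  refine ⟨e', a - e', he', ?_, by abel⟩
  have : f (a - e') = n := by rw [map_sub, hfe, h]; abel
  obtain ⟨l, hl⟩ := hk ((a - e')^k) (by rw [RingHom.mem_ker, map_pow, this, hn])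
  exact ⟨k * l, by rw [pow_mul, hl]⟩

lemma nc_pi {ι : Type*} [Finite ι] {R : ι → Type*} [∀ i, Ring (R i)]
    (h : ∀ i, IsNilCleanRing (R i)) : IsNilCleanRing (∀ i, R i) := by
  intro a
  cases nonempty_fintype ι
  choose e n he hn hen using fun i => h i (a i)
  choose k hk using hn
  refine ⟨e, n, funext he, ⟨∑ i, k i, ?_⟩, funext hen⟩
  funext i
  exact pow_eq_zero_of_le (Finset.single_le_sum (fun _ _ => Nat.zero_le _) (Finset.mem_univ i)) (hk i)

lemma nc_matrix {K : Type*} [Field K] (h01 : ∀ x : K, x = 0 ∨ x = 1) (d : ℕ) :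
    IsNilCleanRing (Matrix (Fin d) (Fin d) K) := by
  have e : Matrix (Fin d) (Fin d) K ≃ₐ[K] Module.End K (Fin d → K) := Matrix.toLinAlgEquiv'
  refine nc_of_hom (e : Matrix (Fin d) (Fin d) K →+* Module.End K (Fin d → K)) e.surjective ?_ ?_
  · intro x hx
    have : e x = 0 := hx
    rw [(map_eq_zero_iff e e.injective).1 this]; exact .zero
  · intro a
    exact end_nc_s14 h01 _ (Fin d → K) rfl a

lemma field_two {K S : Type*} [Field K] [Ring S] (d : ℕ) [NeZero d]
    (f : S →+* Matrix (Fin d) (Fin d) K) (hf : Function.Surjective f)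
    (k : ℕ) (h2 : (2:S)^k = 0) {ι : Type*} [Fintype ι] (ε : ι → S) (hsum : ∑ i, ε i = 1)
    (hε : ∀ i s, ∃ z : ℤ, ε i * s * ε i = z • ε i) (hid : ∀ i, ε i * ε i = ε i) :
    ∀ x : K, x = 0 ∨ x = 1 := by
  have h20 : (2:K) = 0 := by
    have : f (2^k) = 0 := by rw [h2, map_zero]
    have h3 : (2 : Matrix (Fin d) (Fin d) K)^k = 0 := by rwa [map_pow, map_ofNat] at this
    have h4 : Matrix.scalar (Fin d) ((2:K)^k) = 0 := by
      rw [map_pow, map_ofNat, h3]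
    have h5 := congrFun (congrFun h4 0) 0
    simp at h5
    exact h5.1
  obtain ⟨i, hi⟩ : ∃ i, f (ε i) ≠ 0 := by
    by_contra! h
    have : f (∑ i, ε i) = 0 := by rw [map_sum]; exact Finset.sum_eq_zero fun i _ => h i
    rw [hsum, map_one] at this
    exact one_ne_zero this
  intro x
  obtain ⟨s, hs⟩ := hf (Matrix.scalar (Fin d) x)
  obtain ⟨z, hz⟩ := hε i s
  have h6 := congrArg f hz
  rw [map_mul, map_mul, hs, map_zsmul] at h6
  have h7 : f (ε i) * Matrix.scalar (Fin d) x * f (ε i) = x • f (ε i) := by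
    conv_rhs => rw [← hid i, map_mul]
    rw [Matrix.scalar_apply, ← Matrix.smul_one_eq_diagonal]
    simp
  rw [h7, ← Int.cast_smul_eq_zsmul K] at h6
  have h8 : x = z := smul_left_injective K hi h6
  rw [h8]
  rcases Int.even_or_odd' z with ⟨t, rfl | rfl⟩
  · left; push_cast; rw [h20, zero_mul]
  · right; push_cast; rw [h20, zero_mul, zero_add]

lemma nc_finite_ring {R : Type*} [Ring R] [Finite R]
    (k : ℕ) (h2 : (2:R)^k = 0) {ι : Type*} [Fintype ι] (ε : ι → R) (hsum : ∑ i, ε i = 1)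
    (hε : ∀ i s, ∃ z : ℤ, ε i * s * ε i = z • ε i) (hid : ∀ i, ε i * ε i = ε i) :
    IsNilCleanRing R := by
  have hsp : IsSemiprimaryRing R := inferInstance
  have := hsp.isSemisimpleRing
  obtain ⟨n, D, d, _, hd, ⟨e⟩⟩ :=
    IsSemisimpleRing.exists_ringEquiv_pi_matrix_divisionRing (R ⧸ Ring.jacobson R)
  let q : R →+* R ⧸ Ring.jacobson R := Ideal.Quotient.mk _
  have hq : Function.Surjective q := Ideal.Quotient.mk_surjective
  refine nc_of_hom q hq ?_ ?_
  · intro x hx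
    have hx' : x ∈ Ring.jacobson R := by
      rwa [Ideal.mk_ker] at hx
    obtain ⟨l, hl⟩ := hsp.isNilpotent
    refine ⟨l, ?_⟩
    have := Ideal.pow_mem_pow hx' l
    rw [hl] at this
    exact this
  refine nc_of_hom e.toRingHom e.surjective ?_ (nc_pi fun i => ?_)
  · intro x hx
    have : e x = 0 := hx
    rw [e.map_eq_zero_iff] at this
    rw [this]; exact .zero
  let g : R →+* Matrix (Fin (d i)) (Fin (d i)) (D i) :=
    ((Pi.evalRingHom _ i).comp e.toRingHom).comp q
  have hg : Function.Surjective g := by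
    exact ((Function.surjective_eval i).comp e.surjective).comp hq
  have hfin : Finite (D i) := by
    have : Function.Surjective fun r => g r 0 0 := fun x => by
      obtain ⟨r, hr⟩ := hg (Matrix.of fun _ _ => x)
      exact ⟨r, by simp [hr]⟩
    exact Finite.of_surjective _ this
  have h01 := field_two (K := D i) (d i) g hg k h2 ε hsum hε hid
  exact nc_matrix h01 (d i)

theorem end_nilClean_of_finite_two_group (G : Type*) [AddCommGroup G] [Finite G]
    (h : ∃ k : ℕ, Nat.card G = 2 ^ k) :
    IsNilCleanRing (AddMonoid.End G) := by
  classical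
  obtain ⟨k, hk⟩ := h
  obtain ⟨ι, _, n, hn, ⟨e⟩⟩ := AddCommGroup.equiv_directSum_zmod_of_finite' G
  have : Finite (AddMonoid.End G) := Finite.of_injective (fun f : AddMonoid.End G => (f : G → G))
    DFunLike.coe_injective
  let π : ∀ i, G →+ ZMod (n i) := fun i =>
    ((Pi.evalAddMonoidHom _ i).comp (DirectSum.addEquivProd _).toAddMonoidHom).comp e.toAddMonoidHom
  let j : ∀ i, ZMod (n i) →+ G := fun i =>
    e.symm.toAddMonoidHom.comp (DirectSum.of (fun i => ZMod (n i)) i)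
  have hπj : ∀ i x, π i (j i x) = x := by
    intro i x
    simp [π, j, DirectSum.addEquivProd]
    exact DirectSum.of_eq_same (β := fun i => ZMod (n i)) i x
  have hsum : ∀ x, ∑ i, j i (π i x) = x := by
    intro x
    apply e.injective
    rw [map_sum]
    simp only [j, π, DirectSum.addEquivProd]
    simp
    exact DirectSum.sum_univ_of (e x)
  let ε : ι → AddMonoid.End G := fun i => (j i).comp (π i)
  have hεa : ∀ i x, ε i x = j i (π i x) := fun _ _ => rfl
  refine nc_finite_ring k ?_ ε ?_ ?_ ?_
  · ext x
    have : ((2:AddMonoid.End G)^k) = ((2^k : ℕ) : AddMonoid.End G) := by push_cast; rfl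
    rw [this, AddMonoid.End.natCast_apply, ← hk, card_nsmul_eq_zero']
    rfl
  · ext x
    exact (AddMonoidHom.finsetSum_apply (fun i => (j i).comp (π i)) Finset.univ x).trans (hsum x)
  · intro i s
    obtain ⟨z, hz⟩ := ZMod.intCast_surjective (π i (s (j i 1)))
    refine ⟨z, ?_⟩
    ext x
    have h1 : (ε i * s * ε i) x = j i (π i (s (j i (π i x)))) := rfl
    have h2 : (z • ε i) x = z • j i (π i x) := rfl
    rw [h1, h2]
    obtain ⟨t, ht⟩ := ZMod.intCast_surjective (π i x)
    have h3 : π i x = t • (1 : ZMod (n i)) := by rw [← ht]; simp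
    rw [h3, map_zsmul, map_zsmul, map_zsmul, ← hz, ← map_zsmul, ← map_zsmul]
    simp [mul_comm]
  · intro i
    ext x
    have h1 : (ε i * ε i) x = j i (π i (j i (π i x))) := rfl
    rw [h1, hπj]; rfl
end

section
/- A finitely generated abelian group G has nil-clean endomorphism ring End(G) if and only if G is a finite 2-group (a finite group whose order is a power of 2). -/
lemma cyc_aux {W : Type*} [AddCommGroup W] [Module (ZMod 2) W] (φ : Module.End (ZMod 2) W)
    (x : ℕ → W) (hx : ∀ i, φ (x i) = x (i+1)) (n : ℕ) (hn : 0 < n)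
    (hext : ∀ f g : Module.End (ZMod 2) W, (∀ i < n, f (x i) = g (x i)) → f = g)
    (hdef : ∀ y : ℕ → W, ∃ E : Module.End (ZMod 2) W, ∀ i < n, E (x i) = y i)
    (a : ℕ → ZMod 2) (hrel : x n = ∑ i ∈ Finset.range n, a i • x i) :
    ∃ e : Module.End (ZMod 2) W, IsIdempotentElem e ∧ IsNilpotent (φ - e) := by
  have two : ∀ v : W, v + v = 0 := fun v => by
    have : (2 : ZMod 2) • v = 0 := by
      rw [show (2 : ZMod 2) = 0 from rfl, zero_smul]
    rwa [two_smul] at this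
  have neg : ∀ v : W, -v = v := fun v => by
    rw [neg_eq_iff_add_eq_zero]; exact two v
  have z2 : ∀ c : ZMod 2, c = 0 ∨ c = 1 := by decide
  obtain ⟨m, rfl⟩ : ∃ m, n = m + 1 := ⟨n - 1, by omega⟩
  rcases z2 (a m) with h0 | h1
  · -- trace zero
    rcases m with _ | _ | m
    · refine ⟨0, IsIdempotentElem.zero, 1, hext _ _ ?_⟩
      intro i hi
      obtain rfl : i = 0 := by omega
      simp [hx, hrel, h0]
    · have hr : x 2 = a 0 • x 0 := by
        rw [hrel]; simp [Finset.sum_range_succ, h0]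
      have hr3 : x 3 = a 0 • x 1 := by
        rw [← hx, hr, map_smul, hx]
      refine ⟨a 0 • 1, ?_, 2, hext _ _ ?_⟩
      · rcases z2 (a 0) with h | h <;> rw [h] <;> simp [IsIdempotentElem]
      · intro i hi
        rcases z2 (a 0) with h | h <;> rw [h] at hr hr3 ⊢ <;>
        obtain rfl | rfl : i = 0 ∨ i = 1 := by omega
        all_goals simp [pow_two, hx, hr, hr3, sub_eq_add_neg, neg, two]
        · trans (x 0 + x 0) + (x 1 + x 1)
          · abel
          · rw [two, two, add_zero]
        · trans (x 0 + x 0) + (x 1 + x 1)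
          · abel
          · rw [two, two, add_zero]
    · set c : ZMod 2 := a (m+1) + 1 with hc
      have hrel' : x (m+3) = (∑ i ∈ Finset.range (m+1), a i • x i) + a (m+1) • x (m+1) := by
        rw [hrel, Finset.sum_range_succ, h0, zero_smul, add_zero, Finset.sum_range_succ]
      set u := (∑ i ∈ Finset.range (m+1), a i • x i) with hu
      obtain ⟨E, hE⟩ := hdef (fun i => if i < m + 1 then 0 else
        if i = m + 1 then x (m+1) + c • x m else x (m+2) + u + c • x m)
      have hE1 : ∀ i < m + 1, E (x i) = 0 := fun i hi => by
        rw [hE i (by omega), if_pos hi]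
      have hE2 : E (x (m+1)) = x (m+1) + c • x m := by
        rw [hE _ (by omega)]; simp
      have hE3 : E (x (m+2)) = x (m+2) + u + c • x m := by
        rw [hE _ (by omega)]; simp
      have hEu : E u = 0 := by
        rw [hu, map_sum]
        refine Finset.sum_eq_zero fun i hi => ?_
        rw [map_smul, hE1 i (Finset.mem_range.1 hi), smul_zero]
      have hEm : E (x m) = 0 := hE1 m (by omega)
      have hν : ∀ i ≤ m + 1, ((φ - E)^i) (x 0) = x i := by
        intro i
        induction i with
        | zero => simp
        | succ i ih =>
          intro hi
          rw [pow_succ', Module.End.mul_apply, ih (by omega), LinearMap.sub_apply, hx,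
            hE1 i (by omega), sub_zero]
      have hν2 : ((φ - E)^(m+2)) (x 0) = x (m+2) - x (m+1) - c • x m := by
        rw [pow_succ', Module.End.mul_apply, hν _ le_rfl, LinearMap.sub_apply, hx, hE2]
        abel
      have hν3 : ((φ - E)^(m+3)) (x 0) = 0 := by
        rw [pow_succ', Module.End.mul_apply, hν2]
        simp only [LinearMap.sub_apply, map_sub, map_smul, hx, hE2, hE3, hEm, hrel']
        rcases z2 (a (m+1)) with h | h
        · have hc' : c = 1 := by rw [hc, h]; decide
          rw [hc', h]
          simp only [zero_smul, one_smul, sub_eq_add_neg, neg_add, neg, smul_zero]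
          trans (x (m+1) + x (m+1)) + (x (m+2) + x (m+2)) + (x m + x m) + (u + u)
          · abel
          · simp only [two, add_zero]
        · have hc' : c = 0 := by rw [hc, h]; decide
          rw [hc', h]
          simp only [zero_smul, one_smul, sub_eq_add_neg, neg_add, neg, smul_zero]
          trans (x (m+1) + x (m+1)) + (x (m+2) + x (m+2)) + (u + u)
          · abel
          · simp only [two, add_zero]
      have hk : ∀ i, ((φ - E)^(m+3)) (((φ - E)^i) (x 0)) = 0 := by
        intro i
        rw [← Module.End.mul_apply, ← pow_add, add_comm, pow_add, Module.End.mul_apply, hν3,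
          map_zero]
      refine ⟨E, hext _ _ ?_, m + 3, hext _ _ ?_⟩
      · intro i hi
        rw [Module.End.mul_apply]
        rcases Nat.lt_or_ge i (m+1) with h | h
        · rw [hE1 i h, map_zero]
        obtain rfl | rfl : i = m + 1 ∨ i = m + 2 := by omega
        · simp [hE2, hEm]
        · simp [hE3, hEm, hEu]
      · intro i hi
        rw [LinearMap.zero_apply]
        rcases Nat.lt_or_ge i (m+2) with h | h
        · rw [← hν i (by omega)]; exact hk i
        obtain rfl : i = m + 2 := by omega
        have : x (m+2) = ((φ - E)^(m+2)) (x 0) + ((φ - E)^(m+1)) (x 0)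
            + c • ((φ - E)^m) (x 0) := by
          rw [hν2, hν _ le_rfl, hν m (by omega)]; abel
        rw [this, map_add, map_add, map_smul, hk, hk, hk]; simp
  · have hrel' : x (m+1) = (∑ i ∈ Finset.range m, a i • x i) + x m := by
      rw [hrel, Finset.sum_range_succ, h1, one_smul]
    set u := (∑ i ∈ Finset.range m, a i • x i) with hu
    obtain ⟨E, hE⟩ := hdef (fun i => if i < m then 0 else x (m+1))
    have hE1 : ∀ i < m, E (x i) = 0 := fun i hi => by
      rw [hE i (by omega), if_pos hi]
    have hE2 : E (x m) = x (m+1) := by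
      rw [hE _ (by omega)]; simp
    have hEu : E u = 0 := by
      rw [hu, map_sum]
      refine Finset.sum_eq_zero fun i hi => ?_
      rw [map_smul, hE1 i (Finset.mem_range.1 hi), smul_zero]
    have hν : ∀ i ≤ m, ((φ - E)^i) (x 0) = x i := by
      intro i
      induction i with
      | zero => simp
      | succ i ih =>
        intro hi
        rw [pow_succ', Module.End.mul_apply, ih (by omega), LinearMap.sub_apply, hx,
          hE1 i (by omega), sub_zero]
    have hν3 : ((φ - E)^(m+1)) (x 0) = 0 := by
      rw [pow_succ', Module.End.mul_apply, hν _ le_rfl, LinearMap.sub_apply, hx, hE2, sub_self]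
    refine ⟨E, hext _ _ ?_, m + 1, hext _ _ ?_⟩
    · intro i hi
      rw [Module.End.mul_apply]
      rcases Nat.lt_or_ge i m with h | h
      · rw [hE1 i h, map_zero]
      obtain rfl : i = m := by omega
      rw [hE2]
      conv_lhs => rw [hrel']
      rw [map_add, hEu, zero_add, hE2]
    · intro i hi
      rw [← hν i (by omega), ← Module.End.mul_apply, ← pow_add, add_comm, pow_add,
        Module.End.mul_apply, hν3, map_zero, LinearMap.zero_apply]

lemma cyc_sub {V : Type*} [AddCommGroup V] [Module (ZMod 2) V] [Module.Finite (ZMod 2) V]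
    (φ : Module.End (ZMod 2) V) (w : V) (hw : w ≠ 0) :
    ∃ (W : Submodule (ZMod 2) V) (hW : ∀ v ∈ W, φ v ∈ W), w ∈ W ∧
      (∀ F : Submodule (ZMod 2) V, (∀ v ∈ F, φ v ∈ F) → w ∈ F → W ≤ F) ∧
      ∃ e : Module.End (ZMod 2) W, IsIdempotentElem e ∧ IsNilpotent (φ.restrict hW - e) := by
  set X : ℕ → V := fun i => (φ^i) w with hX
  have hXs : ∀ i, φ (X i) = X (i+1) := fun i => by
    simp only [hX, pow_succ', Module.End.mul_apply]
  have hex : ∃ n, ¬ LinearIndependent (ZMod 2) (fun i : Fin n => X i) := by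
    refine ⟨Module.finrank (ZMod 2) V + 1, fun h => ?_⟩
    have := h.fintype_card_le_finrank
    simp at this
  classical
  obtain ⟨n, hn1, hn2⟩ : ∃ n, LinearIndependent (ZMod 2) (fun i : Fin n => X i) ∧
      ¬ LinearIndependent (ZMod 2) (fun i : Fin (n+1) => X i) := by
    have h0 : Nat.find hex ≠ 0 := by
      intro h
      have := Nat.find_spec hex
      rw [h] at this
      exact this linearIndependent_empty_type
    refine ⟨Nat.find hex - 1, ?_, ?_⟩
    · have := Nat.find_min hex (m := Nat.find hex - 1) (by omega)
      exact not_not.1 this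
    · have := Nat.find_spec hex
      rwa [Nat.sub_add_cancel (by omega)]
  have hmem : X n ∈ Submodule.span (ZMod 2) (Set.range (fun i : Fin n => X i)) := by
    by_contra hc
    apply hn2
    rw [linearIndependent_finSucc']
    exact ⟨hn1, hc⟩
  have hn0 : 0 < n := by
    rcases Nat.eq_zero_or_pos n with h | h
    · subst h
      simp [hX] at hmem
      exact absurd hmem hw
    · exact h
  set W := Submodule.span (ZMod 2) (Set.range (fun i : Fin n => X i)) with hWdef
  have hXW : ∀ i ≤ n, X i ∈ W := by
    intro i hi
    rcases hi.lt_or_eq with h | rfl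
    · exact Submodule.subset_span ⟨⟨i, h⟩, rfl⟩
    · exact hmem
  have hW : ∀ v ∈ W, φ v ∈ W := by
    have : W ≤ W.comap φ := by
      rw [hWdef, Submodule.span_le, ← hWdef]
      rintro _ ⟨i, rfl⟩
      simp only [Submodule.comap_coe, Set.mem_preimage, SetLike.mem_coe, hXs]
      exact hXW _ i.2
    exact this
  have hXW' : ∀ i, X i ∈ W := by
    intro i
    induction i with
    | zero => exact hXW 0 (by omega)
    | succ i ih => rw [← hXs]; exact hW _ ih
  refine ⟨W, hW, by simpa [hX] using hXW 0 (by omega), ?_, ?_⟩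
  · intro F hF hwF
    rw [hWdef, Submodule.span_le]
    rintro _ ⟨i, rfl⟩
    have : ∀ i, X i ∈ F := by
      intro i
      induction i with
      | zero => simpa [hX] using hwF
      | succ i ih => rw [← hXs]; exact hF _ ih
    exact this i
  · let b : Module.Basis (Fin n) (ZMod 2) W := Module.Basis.span hn1
    have hb : ∀ i, b i = ⟨X i, hXW' i⟩ := fun i => by
      exact Module.Basis.span_apply hn1 i
    refine cyc_aux (φ.restrict hW) (fun i => ⟨X i, hXW' i⟩) ?_ n hn0 ?_ ?_
      (fun i => if h : i < n then b.repr ⟨X n, hXW' n⟩ ⟨i, h⟩ else 0) ?_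
    · intro i
      apply Subtype.ext
      simp [hXs]
    · intro f g hfg
      apply b.ext
      intro i
      rw [hb]
      exact hfg i i.2
    · intro y
      refine ⟨b.constr (ZMod 2) (fun i => y i), ?_⟩
      intro i hi
      have := b.constr_basis (ZMod 2) (fun i => y i) ⟨i, hi⟩
      rwa [hb] at this
    · rw [Finset.sum_range]
      conv_lhs => rw [← b.sum_repr ⟨X n, hXW' n⟩]
      refine Finset.sum_congr rfl fun i _ => ?_
      rw [hb]
      simp

universe u

lemma flag_nilclean (d : ℕ) : ∀ {V : Type u} [AddCommGroup V] [Module (ZMod 2) V]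
    [Module.Finite (ZMod 2) V] (_ : Module.finrank (ZMod 2) V = d)
    (φ : Module.End (ZMod 2) V) (F : ℕ → Submodule (ZMod 2) V) (_ : Antitone F)
    (_ : F 0 = ⊤) (N : ℕ) (_ : F N = ⊥) (_ : ∀ k, ∀ v ∈ F k, φ v ∈ F k),
    ∃ e : Module.End (ZMod 2) V, IsIdempotentElem e ∧ IsNilpotent (φ - e) ∧
      ∀ k, ∀ v ∈ F k, e v ∈ F k := by
  induction d using Nat.strong_induction_on with
  | _ d ih =>
  intro V _ _ _ hd φ F hF hF0 N hN hφ
  rcases subsingleton_or_nontrivial V with hs | hs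
  · refine ⟨0, IsIdempotentElem.zero, ⟨1, Subsingleton.elim _ _⟩, by simp⟩
  classical
  have hex : ∃ N, F N = ⊥ := ⟨N, hN⟩
  have hf0 : Nat.find hex ≠ 0 := by
    intro h
    have := Nat.find_spec hex
    rw [h, hF0] at this
    exact top_ne_bot this
  obtain ⟨w, hwF, hw⟩ := Submodule.exists_mem_ne_zero_of_ne_bot
    (Nat.find_min hex (m := Nat.find hex - 1) (by omega))
  have hk : ∀ k, F k = ⊥ ∨ w ∈ F k := by
    intro k
    rcases Nat.lt_or_ge k (Nat.find hex) with h | h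
    · exact Or.inr (hF (by omega) hwF)
    · left
      have := hF h
      rw [Nat.find_spec hex] at this
      exact le_bot_iff.1 this
  obtain ⟨W, hW, hwW, hmin, e1, he1, hn1⟩ := cyc_sub φ w hw
  have hlt : Module.finrank (ZMod 2) (V ⧸ W) < d := by
    rw [← hd]
    have h1 := W.finrank_quotient_add_finrank
    have : 0 < Module.finrank (ZMod 2) W := by
      rw [Module.finrank_pos_iff]
      exact ⟨⟨w, hwW⟩, 0, fun h => hw (congrArg Subtype.val h)⟩
    omega
  set φ2 : Module.End (ZMod 2) (V ⧸ W) := W.mapQ W φ hW with hφ2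
  obtain ⟨e2, he2, hn2, hF2⟩ := ih _ hlt rfl φ2 (fun k => (F k).map W.mkQ)
    (fun i j hij => Submodule.map_mono (hF hij)) (by simp [hF0]) N (by simp [hN]) (by
      rintro k _ ⟨v, hv, rfl⟩
      exact ⟨φ v, hφ k v hv, by simp [hφ2]⟩)
  obtain ⟨s, hs⟩ := W.mkQ.exists_rightInverse_of_surjective (by simp)
  have hs' : ∀ q, W.mkQ (s q) = q := fun q => LinearMap.congr_fun hs q
  let p : V →ₗ[ZMod 2] W := LinearMap.codRestrict W (LinearMap.id - s ∘ₗ W.mkQ) (by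
    intro v
    apply (Submodule.Quotient.mk_eq_zero W).1
    change W.mkQ _ = 0
    simp only [LinearMap.sub_apply, map_sub, LinearMap.comp_apply, hs', LinearMap.id_apply,
      sub_self])
  have hp : ∀ v, (p v : V) = v - s (W.mkQ v) := fun v => rfl
  have hps : ∀ q, p (s q) = 0 := fun q => by
    apply Subtype.ext
    rw [hp, hs', sub_self]; rfl
  have hmk : ∀ v : W, W.mkQ (v : V) = 0 := fun v => by simp
  have hpi : ∀ v : W, p (v : V) = v := fun v => by
    apply Subtype.ext
    rw [hp, hmk, map_zero, sub_zero]
  let e : Module.End (ZMod 2) V := W.subtype ∘ₗ e1 ∘ₗ p + s ∘ₗ e2 ∘ₗ W.mkQ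
  have he : ∀ v, e v = (e1 (p v) : V) + s (e2 (W.mkQ v)) := fun v => rfl
  have hmke : ∀ v, W.mkQ (e v) = e2 (W.mkQ v) := fun v => by
    rw [he, map_add, hmk, hs', zero_add]
  have hpe : ∀ v, p (e v) = e1 (p v) := fun v => by
    rw [he, map_add, hpi, hps, add_zero]
  refine ⟨e, ?_, ?_, ?_⟩
  · apply LinearMap.ext
    intro v
    rw [Module.End.mul_apply, he (e v), hpe, hmke, ← Module.End.mul_apply, he1,
      ← Module.End.mul_apply, he2, he]
  · obtain ⟨a, ha⟩ := hn2
    obtain ⟨c, hc⟩ := hn1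
    have q1 : ∀ k v, W.mkQ (((φ - e)^k) v) = ((φ2 - e2)^k) (W.mkQ v) := by
      intro k
      induction k with
      | zero => intro v; rfl
      | succ k ih =>
        intro v
        rw [pow_succ, Module.End.mul_apply, ih, pow_succ, Module.End.mul_apply]
        congr 1
        rw [LinearMap.sub_apply, map_sub, hmke]
        rfl
    have q2 : ∀ k (v : W), ((φ - e)^k) (v : V) = (((φ.restrict hW - e1)^k) v : W) := by
      intro k
      induction k with
      | zero => intro v; rfl
      | succ k ih =>
        intro v
        rw [pow_succ, Module.End.mul_apply, pow_succ, Module.End.mul_apply, ← ih]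
        congr 1
        rw [LinearMap.sub_apply, he, hpi, hmk, map_zero, map_zero, add_zero]
        rfl
    refine ⟨c + a, LinearMap.ext fun v => ?_⟩
    rw [pow_add, Module.End.mul_apply]
    have : ((φ - e)^a) v ∈ W := by
      rw [← Submodule.ker_mkQ W, LinearMap.mem_ker, q1, ha]; rfl
    have h3 := q2 c ⟨_, this⟩
    rw [hc] at h3
    exact h3
  · intro k v hv
    rcases hk k with h | h
    · rw [h] at hv ⊢
      rw [(Submodule.mem_bot _).1 hv]; simp
    · have hWF := hmin (F k) (hφ k) h
      obtain ⟨y, hy, hy2⟩ := hF2 k (W.mkQ v) ⟨v, hv, rfl⟩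
      have : e v - y ∈ W := by
        rw [← Submodule.ker_mkQ W, LinearMap.mem_ker, map_sub, hmke, hy2, sub_self]
      have := (F k).add_mem (hWF this) hy
      simpa using this
open DirectSum in
lemma decomp (G : Type*) [AddCommGroup G] [Finite G] (K : ℕ) (hK : ∀ g : G, 2^K • g = 0) :
    ∃ (d : ℕ) (k : Fin d → ℕ) (g : Fin d → G), (∀ i, (2^(k i)) • g i = 0) ∧
      (∀ h : Fin d → G, (∀ i, (2^(k i)) • h i = 0) → ∃ ψ : G →+ G, ∀ i, ψ (g i) = h i) ∧
      (∀ v : G, 2 • v = 0 → ∃ c : Fin d → ℤ, v = ∑ i, c i • ((2^(k i - 1)) • g i)) := by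
  classical
  have hp : Irreducible (2 : ℤ) := Int.prime_two.irreducible
  have htor : Module.IsTorsion' G (Submonoid.powers (2 : ℤ)) := by
    intro x
    refine ⟨⟨2^K, K, rfl⟩, ?_⟩
    have := hK x
    change (2^K : ℤ) • x = 0
    rw [← this, ← natCast_zsmul]; simp
  obtain ⟨d, k, ⟨f⟩⟩ := Module.torsion_by_prime_power_decomposition hp htor
  let o : ∀ i, (ℤ ⧸ Submodule.span ℤ {(2:ℤ)^k i}) := fun i => Submodule.Quotient.mk 1
  have ho : ∀ i, ((2:ℤ)^k i) • o i = 0 := by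
    intro i
    rw [← Submodule.Quotient.mk_smul, Submodule.Quotient.mk_eq_zero]
    simp [Submodule.mem_span_singleton]
  refine ⟨d, k, fun i => f.symm (DirectSum.lof ℤ (Fin d) _ i (o i)), ?_, ?_, ?_⟩
  · intro i
    rw [← natCast_zsmul]
    push_cast
    rw [← map_smul, ← map_smul, ho]; simp
  · intro h hh
    let ψ : (⨁ i, (ℤ ⧸ Submodule.span ℤ {(2:ℤ)^k i})) →ₗ[ℤ] G :=
      DirectSum.toModule ℤ (Fin d) G fun i =>
        Submodule.liftQ _ (LinearMap.toSpanSingleton ℤ G (h i)) (by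
          rw [Submodule.span_singleton_le_iff_mem, LinearMap.mem_ker,
            LinearMap.toSpanSingleton_apply, ← hh i, ← natCast_zsmul]
          push_cast; rfl)
    refine ⟨(ψ ∘ₗ f.toLinearMap).toAddMonoidHom, fun i => ?_⟩
    simp [ψ, o, DirectSum.toModule_lof]
    exact one_zsmul _
  · intro v hv
    have hc : ∀ i, ∃ c : ℤ, f v i = c • ((2:ℤ)^(k i - 1) • o i) := by
      intro i
      obtain ⟨z, hz⟩ := Submodule.Quotient.mk_surjective _ (f v i)
      have h2 : (2 : ℤ) • f v i = 0 := by
        have : f ((2:ℤ) • v) = 0 := by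
          rw [show (2:ℤ) • v = 2 • v by rw [← natCast_zsmul]; rfl, hv, map_zero]
        rw [map_smul] at this
        have := congrArg (fun t => t i) this
        exact this
      rw [← hz, ← Submodule.Quotient.mk_smul, Submodule.Quotient.mk_eq_zero,
        Submodule.mem_span_singleton] at h2
      obtain ⟨y, hy⟩ := h2
      simp only [smul_eq_mul] at hy
      have : ∃ c, z = c * 2^(k i - 1) := by
        rcases Nat.eq_zero_or_pos (k i) with h | h
        · exact ⟨z, by simp [h]⟩
        · refine ⟨y, ?_⟩
          obtain ⟨j, hj⟩ : ∃ j, k i = j + 1 := ⟨k i - 1, by omega⟩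
          rw [hj] at hy ⊢
          simp only [Nat.add_sub_cancel]
          rw [pow_succ] at hy
          linarith
      obtain ⟨c, rfl⟩ := this
      refine ⟨c, ?_⟩
      rw [← hz, ← Submodule.Quotient.mk_smul, ← Submodule.Quotient.mk_smul]
      simp
    choose c hc using hc
    refine ⟨c, f.injective ?_⟩
    rw [map_sum]
    conv_lhs => rw [← DirectSum.sum_univ_of (f v)]
    refine Finset.sum_congr rfl fun i _ => ?_
    beta_reduce
    rw [hc, ← natCast_zsmul, map_zsmul f, map_zsmul f, f.apply_symm_apply, ← DirectSum.lof_eq_of ℤ,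
      map_smul, map_smul]
    push_cast; rfl

lemma nilp_of_ker (G : Type*) [AddCommGroup G] (K : ℕ) (hK : ∀ g : G, 2^K • g = 0)
    (β : AddMonoid.End G) (hβ : ∀ v, 2 • v = 0 → β v = 0) : IsNilpotent β := by
  have key : ∀ j, ∀ g : G, 2^j • g = 0 → (β^j) g = 0 := by
    intro j
    induction j with
    | zero => intro g hg; simpa using hg
    | succ j ih =>
      intro g hg
      rw [pow_succ]
      change (β^j) (β g) = 0
      apply ih
      rw [← map_nsmul]
      apply hβ
      rw [← mul_nsmul, ← hg, pow_succ]
  exact ⟨K, AddMonoidHom.ext fun g => key K g (hK g)⟩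

def sock (G : Type*) [AddCommGroup G] : AddSubgroup G := (nsmulAddMonoidHom 2 : G →+ G).ker

lemma mem_sock {G : Type*} [AddCommGroup G] (v : G) : v ∈ sock G ↔ 2 • v = 0 := Iff.rfl

instance sockMod (G : Type*) [AddCommGroup G] : Module (ZMod 2) (sock G) :=
  AddCommGroup.zmodModule fun x => Subtype.ext x.2

def resHom (G : Type*) [AddCommGroup G] : AddMonoid.End G →+* Module.End (ZMod 2) (sock G) where
  toFun φ := AddMonoidHom.toZModLinearMap 2
    ((φ.comp (sock G).subtype).codRestrict (sock G) (fun v => by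
      rw [mem_sock]
      change 2 • φ (v : G) = 0
      rw [← map_nsmul, (mem_sock _).1 v.2, map_zero]))
  map_one' := rfl
  map_mul' _ _ := rfl
  map_zero' := rfl
  map_add' _ _ := rfl

lemma resHom_apply (G : Type*) [AddCommGroup G] (φ : AddMonoid.End G) (v : sock G) :
    ((resHom G φ v : sock G) : G) = φ v := rfl

lemma backward (G : Type*) [AddCommGroup G] [Finite G] (K : ℕ) (hK : ∀ g : G, 2^K • g = 0) :
    IsNilCleanRing (AddMonoid.End G) := by
  intro φ
  have hker : ∀ x ∈ RingHom.ker (resHom G), IsNilpotent x := by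
    intro x hx
    refine nilp_of_ker G K hK x fun v hv => ?_
    rw [RingHom.mem_ker] at hx
    rw [← resHom_apply G x ⟨v, hv⟩, hx]; rfl
  let F : ℕ → Submodule (ZMod 2) (sock G) := fun k => AddSubgroup.toZModSubmodule 2
    ((nsmulAddMonoidHom (2^k) : G →+ G).range.comap (sock G).subtype)
  have hFm : ∀ k (v : sock G), v ∈ F k ↔ ∃ g : G, 2^k • g = (v : G) := fun k v => Iff.rfl
  have : Module.Finite (ZMod 2) (sock G) := Module.Finite.of_finite
  obtain ⟨e, he, hn, hF⟩ := flag_nilclean _ rfl (resHom G φ) F (by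
      intro i j hij v hv
      rw [hFm] at hv ⊢
      obtain ⟨g, hg⟩ := hv
      refine ⟨2^(j-i) • g, ?_⟩
      rw [← hg, ← mul_nsmul', ← pow_add]
      congr 2; omega) (by
      rw [eq_top_iff]
      intro v _
      rw [hFm]
      exact ⟨v, by simp⟩) K (by
      rw [eq_bot_iff]
      intro v hv
      rw [hFm] at hv
      obtain ⟨g, hg⟩ := hv
      rw [hK] at hg
      exact (Submodule.mem_bot _).2 (Subtype.ext hg.symm)) (by
      intro k v hv
      rw [hFm] at hv ⊢
      obtain ⟨g, hg⟩ := hv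
      exact ⟨φ g, by rw [← map_nsmul, hg, resHom_apply]⟩)
  obtain ⟨d, k, g, hg, hext, hgen⟩ := decomp G K hK
  have hv : ∀ i, (2^(k i - 1)) • g i ∈ sock G := by
    intro i
    rw [mem_sock]
    rcases Nat.eq_zero_or_pos (k i) with h | h
    · have := hg i
      rw [h, pow_zero, one_smul] at this
      rw [this]; simp
    · rw [← mul_nsmul, ← pow_succ, Nat.sub_add_cancel h, hg]
  have hh : ∀ i, ∃ h : G, 2^(k i) • h = 0 ∧ 2^(k i - 1) • h = (e ⟨_, hv i⟩ : G) := by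
    intro i
    obtain ⟨h, hh⟩ := (hFm _ _).1 (hF (k i - 1) ⟨_, hv i⟩ ((hFm _ _).2 ⟨g i, rfl⟩))
    rcases Nat.eq_zero_or_pos (k i) with h0 | h0
    · refine ⟨0, by simp, ?_⟩
      have h1 := hg i
      rw [h0, pow_zero, one_smul] at h1
      have : (⟨_, hv i⟩ : sock G) = 0 := Subtype.ext (by simp [h1])
      rw [this]; simp
    · refine ⟨h, ?_, hh⟩
      have := (mem_sock _).1 (e ⟨_, hv i⟩).2
      rw [← hh, ← mul_nsmul, ← pow_succ, Nat.sub_add_cancel h0] at this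
      exact this
  choose h hh1 hh2 using hh
  obtain ⟨ψ, hψ⟩ := hext h hh1
  have hrange : e ∈ (resHom G).range := by
    refine ⟨ψ, LinearMap.ext fun v => ?_⟩
    obtain ⟨c, hc⟩ := hgen v v.2
    have hv' : v = ∑ i, c i • (⟨_, hv i⟩ : sock G) := by
      apply Subtype.ext
      rw [hc]
      push_cast
      rfl
    rw [hv', map_sum, map_sum]
    refine Finset.sum_congr rfl fun i _ => ?_
    rw [map_zsmul, map_zsmul]
    congr 1
    apply Subtype.ext
    rw [← hh2, ← hψ]
    exact map_nsmul ψ _ _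
  obtain ⟨e', he', rfl⟩ := exists_isIdempotentElem_eq_of_ker_isNilpotent (resHom G) hker e hrange he
  refine ⟨e', φ - e', he', ?_, by abel⟩
  obtain ⟨m, hm⟩ := hn
  rw [← map_sub, ← map_pow] at hm
  obtain ⟨l, hl⟩ := hker _ hm
  exact ⟨m * l, by rw [pow_mul, hl]⟩

lemma two_nilp {R : Type*} [Ring R] (h : IsNilCleanRing R) : IsNilpotent (2 : R) := by
  obtain ⟨e, n, he, hn, h2⟩ := h 2
  have hne : n * e = e := by
    have : n = 2 - e := by rw [h2]; abel
    rw [this, sub_mul, he.eq, two_mul]; abel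
  have : ∀ k, n^k * e = e := by
    intro k
    induction k with
    | zero => simp
    | succ k ih => rw [pow_succ, mul_assoc, hne, ih]
  obtain ⟨k, hk⟩ := hn
  have he0 : e = 0 := by rw [← this k, hk, zero_mul]
  rw [h2, he0, zero_add]
  exact ⟨k, hk⟩

theorem fg_end_nilClean_iff_finite_two_group (G : Type*) [AddCommGroup G]
    (hfg : AddGroup.FG G) :
    IsNilCleanRing (AddMonoid.End G) ↔ (Finite G ∧ ∃ k : ℕ, Nat.card G = 2 ^ k) := by
  constructor
  · intro h
    obtain ⟨k, hk⟩ := two_nilp h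
    have hG : ∀ g : G, 2^k • g = 0 := by
      intro g
      have h1 : ((2^k : ℕ) : AddMonoid.End G) g = 0 := by
        rw [show ((2^k : ℕ) : AddMonoid.End G) = 2^k from by norm_cast, hk]; rfl
      rwa [AddMonoid.End.natCast_apply] at h1
    have hfin : Finite G := by
      have : Module.Finite ℤ G := Module.Finite.iff_addGroup_fg.mpr hfg
      refine Module.finite_of_fg_torsion G ?_
      intro g
      refine ⟨⟨2^k, mem_nonZeroDivisors_of_ne_zero (by positivity)⟩, ?_⟩
      change (2^k : ℤ) • g = 0
      rw [← hG g, ← natCast_zsmul]; simp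
    refine ⟨hfin, ?_⟩
    have hp : IsPGroup 2 (Multiplicative G) := by
      intro g
      exact ⟨k, hG g.toAdd⟩
    have : Fact (Nat.Prime 2) := ⟨Nat.prime_two⟩
    obtain ⟨n, hn⟩ := IsPGroup.iff_card.1 hp
    exact ⟨n, hn⟩
  · rintro ⟨hfin, k, hk⟩
    refine backward G k fun g => ?_
    rw [← hk]
    exact card_nsmul_eq_zero'
end
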